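/- arXiv:2410.22329 — 5 statements merged into one kernel-verified Lean document; each statement's English description precedes it below -/
import Mathlib

section
/- Let n, m, k, ℓ be integers with m ≥ 1, ℓ ≥ 0 and ℓ + 1 ≤ k ≤ n. The number of distinct Schubert matroids on ground set [n] (i.e. distinct base families B_{I,π} over all subsets I ⊆ [n] and permutations π ∈ S_n) of rank m (|I| = m), with exactly ℓ loops (exactly ℓ elements of [n] lie in no member of the family), and with cogirth exactly n + 1 − k, equals Σ_{I ⊆ {ℓ+1,…,k}, ℓ+1 ∈ I, k ∈ I, |I| = m} binom(n, ΔI). -/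
open Finset

/-- The total order `≤_π` on `{1,…,n}` determined by `π ∈ S_n`:
`π(1) ≤_π π(2) ≤_π … ≤_π π(n)`. -/
def piLE {n : ℕ} (π : Equiv.Perm (Fin n)) (a b : Fin n) : Prop :=
  π.symm a ≤ π.symm b

instance {n : ℕ} (π : Equiv.Perm (Fin n)) : DecidableRel (piLE π) :=
  fun a b => inferInstanceAs (Decidable (π.symm a ≤ π.symm b))

instance {n : ℕ} (π : Equiv.Perm (Fin n)) : IsTrans (Fin n) (piLE π) :=
  ⟨fun _ _ _ h₁ h₂ => le_trans h₁ h₂⟩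

instance {n : ℕ} (π : Equiv.Perm (Fin n)) : IsAntisymm (Fin n) (piLE π) :=
  ⟨fun _ _ h₁ h₂ => π.symm.injective (le_antisymm h₁ h₂)⟩

instance {n : ℕ} (π : Equiv.Perm (Fin n)) : IsTotal (Fin n) (piLE π) :=
  ⟨fun a b => le_total (π.symm a) (π.symm b)⟩

/-- The elements of `I`, listed increasingly with respect to `≤_π`. -/
def piSort {n : ℕ} (π : Equiv.Perm (Fin n)) (I : Finset (Fin n)) : List (Fin n) :=
  I.sort (piLE π)

/-- `I ≤_π J`: listing `I` and `J` increasingly with respect to `≤_π`, each element of `I`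
is `≤_π` the corresponding element of `J` (this forces `|I| = |J|`). -/
def piDom {n : ℕ} (π : Equiv.Perm (Fin n)) (I J : Finset (Fin n)) : Prop :=
  List.Forall₂ (piLE π) (piSort π I) (piSort π J)

instance {n : ℕ} (π : Equiv.Perm (Fin n)) (I J : Finset (Fin n)) :
    Decidable (piDom π I J) :=
  inferInstanceAs (Decidable (List.Forall₂ _ _ _))

/-- The set of bases `B_{I,π} = {J ⊆ [n] : |J| = |I|, I ≤_π J}` of the Schubert
matroid `S_{I,π}`. -/
def schubertBases {n : ℕ} (π : Equiv.Perm (Fin n)) (I : Finset (Fin n)) :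
    Finset (Finset (Fin n)) :=
  Finset.univ.filter fun J => J.card = I.card ∧ piDom π I J

/-- Differences list: `diffList N prev [m₁,…,m_s] = [m₁ - prev, m₂ - m₁, …, N - m_s]`. -/
def diffList (N : ℕ) : ℕ → List ℕ → List ℕ
  | prev, [] => [N - prev]
  | prev, m :: ms => (m - prev) :: diffList N m ms

/-- The minima of the maximal blocks of consecutive integers of `I`, listed increasingly. -/
def blockMinima (I : Finset ℕ) : List ℕ :=
  (I.filter fun i => i - 1 ∉ I).sort (· ≤ ·)

/-- The multinomial coefficient `binom(n, ΔI)`: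
for `I` with block minima `m₁ < … < m_s` this is
`n! / ((m₁-1)! (m₂-m₁)! ⋯ (m_s-m_{s-1})! (n-m_s+1)!)`, and `1` for `I = ∅`. -/
def binomDelta (n : ℕ) (I : Finset ℕ) : ℕ :=
  n.factorial / ((diffList (n + 1) 1 (blockMinima I)).map Nat.factorial).prod

/-- Two lists sorted by the key `f` are related termwise as soon as every initial segment of the
key values contains at most as many terms of the second list as of the first. -/
theorem forall₂_of_countP_le {α : Type*} (f : α → ℕ) :
    ∀ (L₁ L₂ : List α), L₁.length = L₂.length →
      L₁.Pairwise (fun a b => f a ≤ f b) → L₂.Pairwise (fun a b => f a ≤ f b) →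
      (∀ p, L₂.countP (fun x => f x < p) ≤ L₁.countP (fun x => f x < p)) →
      List.Forall₂ (fun a b => f a ≤ f b) L₁ L₂
  | [], [], _, _, _, _ => .nil
  | [], _ :: _, h, _, _, _ => by simp at h
  | _ :: _, [], h, _, _, _ => by simp at h
  | a :: l₁, b :: l₂, hlen, h₁, h₂, hc => by
    rw [List.pairwise_cons] at h₁ h₂
    have hab : f a ≤ f b := by
      have h := hc (f b + 1)
      have hpos : 0 < (b :: l₂).countP (fun x => f x < f b + 1) :=
        List.countP_pos_iff.2 ⟨b, by simp, by simp⟩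
      obtain ⟨c, hc, hcb⟩ := List.countP_pos_iff.1 (hpos.trans_le h)
      have hcb' : f c < f b + 1 := by simpa using hcb
      rcases List.mem_cons.1 hc with rfl | hc
      · omega
      · have := h₁.1 c hc
        omega
    refine .cons hab (forall₂_of_countP_le f l₁ l₂ (by simpa using hlen) h₁.2 h₂.2 fun p => ?_)
    have h := hc p
    rw [List.countP_cons, List.countP_cons] at h
    by_cases hb : f b < p
    · have ha : f a < p := by omega
      simpa [ha, hb] using h
    · have hz : l₂.countP (fun x => f x < p) = 0 := by
        rw [List.countP_eq_zero]
        intro c hc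
        have := h₂.1 c hc
        simp only [decide_eq_true_eq]
        omega
      omega

theorem countP_le_of_forall₂ {α : Type*} (f : α → ℕ) (p : ℕ) {L₁ L₂ : List α}
    (h : List.Forall₂ (fun a b => f a ≤ f b) L₁ L₂) :
    L₂.countP (fun x => f x < p) ≤ L₁.countP (fun x => f x < p) := by
  induction h with
  | nil => simp
  | @cons a b l₁ l₂ hab _ ih =>
    rw [List.countP_cons, List.countP_cons]
    simp only [decide_eq_true_eq]
    split_ifs <;> omega

/-- The position, counted from `1`, of `x` in the order `≤_π`. -/
def position {n : ℕ} (π : Equiv.Perm (Fin n)) (x : Fin n) : ℕ := (π.symm x : ℕ) + 1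

/-- The subset of `[n]` occupying the positions `Q` in the order `≤_π`. -/
def atPositions {n : ℕ} (π : Equiv.Perm (Fin n)) (Q : Finset ℕ) : Finset (Fin n) :=
  {x | position π x ∈ Q}

section

variable {n : ℕ} {π π' : Equiv.Perm (Fin n)} {Q Q' : Finset ℕ} {J : Finset (Fin n)}

theorem position_injective (π : Equiv.Perm (Fin n)) : Function.Injective (position π) := by
  intro x y h
  apply π.symm.injective
  apply Fin.ext
  simpa [position] using h

theorem one_le_position (π : Equiv.Perm (Fin n)) (x : Fin n) : 1 ≤ position π x := by
  simp [position]

theorem position_le (π : Equiv.Perm (Fin n)) (x : Fin n) : position π x ≤ n := by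
  have := (π.symm x).isLt
  simp only [position]
  omega

theorem exists_position_eq (π : Equiv.Perm (Fin n)) {p : ℕ} (h1 : 1 ≤ p) (hn : p ≤ n) :
    ∃ x, position π x = p :=
  ⟨π ⟨p - 1, by omega⟩, by simp [position]; omega⟩

@[simp] theorem mem_atPositions {x : Fin n} : x ∈ atPositions π Q ↔ position π x ∈ Q := by
  simp [atPositions]

theorem card_filter_position (π : Equiv.Perm (Fin n)) (hQ : Q ⊆ Icc 1 n) :
    #{x | position π x ∈ Q} = #Q := by
  rw [← card_image_of_injective _ (position_injective π)]
  congr 1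
  ext p
  simp only [mem_image, mem_filter, mem_univ, true_and]
  constructor
  · rintro ⟨x, hx, rfl⟩
    exact hx
  · intro hp
    obtain ⟨h1, hn⟩ := mem_Icc.1 (hQ hp)
    obtain ⟨x, rfl⟩ := exists_position_eq π h1 hn
    exact ⟨x, hp, rfl⟩

theorem card_position_lt (π : Equiv.Perm (Fin n)) {a : ℕ} (ha : a ≤ n + 1) :
    #{x | position π x < a} = a - 1 := by
  have h := card_filter_position π (Q := Ico 1 a) (fun p hp => by
    simp only [mem_Ico, mem_Icc] at *
    omega)
  rw [Nat.card_Ico] at h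
  rw [← h]
  congr 1
  ext x
  have := one_le_position π x
  simp only [mem_filter, mem_univ, true_and, mem_Ico]
  omega

theorem card_filter_eq_countP_sort (π : Equiv.Perm (Fin n)) (I : Finset (Fin n)) (p : ℕ) :
    #{x ∈ I | position π x < p} = (piSort π I).countP (fun x => position π x < p) := by
  have h : (I.filter (fun x => position π x < p)).card
      = Multiset.countP (fun x => position π x < p) I.val := by
    rw [Multiset.countP_eq_card_filter]
    rfl
  rw [h, ← Finset.sort_eq I (piLE π), Multiset.coe_countP]
  rfl

theorem card_filter_atPositions (hQ : Q ⊆ Icc 1 n) (p : ℕ) :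
    #{x ∈ atPositions π Q | position π x < p} = #{q ∈ Q | q < p} := by
  rw [← card_filter_position π ((filter_subset (· < p) Q).trans hQ)]
  congr 1
  ext x
  simp

/-- Membership in a Schubert matroid through the cardinalities of initial segments. -/
theorem mem_schubertBases_iff (hQ : Q ⊆ Icc 1 n) :
    J ∈ schubertBases π (atPositions π Q) ↔
      #J = #Q ∧ ∀ p, #{x ∈ J | position π x < p} ≤ #{q ∈ Q | q < p} := by
  have hcard : #(atPositions π Q) = #Q := card_filter_position π hQ
  have hcount := card_filter_atPositions (π := π) hQ
  have hrel : piLE π = fun a b => position π a ≤ position π b := by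
    ext a b
    simp [piLE, position]
  have hsort (I : Finset (Fin n)) :
      (piSort π I).Pairwise (fun a b => position π a ≤ position π b) := by
    rw [← hrel]
    exact Finset.pairwise_sort I (piLE π)
  simp only [schubertBases, mem_filter, mem_univ, true_and, hcard, piDom]
  refine and_congr_right fun hJ => ⟨fun h p => ?_, fun h => ?_⟩
  · rw [← hcount, card_filter_eq_countP_sort, card_filter_eq_countP_sort]
    rw [hrel] at h
    exact countP_le_of_forall₂ _ p h
  · have := forall₂_of_countP_le (position π) (piSort π (atPositions π Q)) (piSort π J)
      (by simp [piSort, hcard, hJ]) (hsort _) (hsort _) fun p => by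
        rw [← card_filter_eq_countP_sort, ← card_filter_eq_countP_sort, hcount]
        exact h p
    rwa [← hrel] at this

theorem atPositions_mem_schubertBases (hQ : Q ⊆ Icc 1 n) :
    atPositions π Q ∈ schubertBases π (atPositions π Q) := by
  rw [mem_schubertBases_iff hQ]
  exact ⟨card_filter_position π hQ, fun p => (card_filter_atPositions hQ p).le⟩

end

/-- The largest element of `M` that is at most `p`, and `0` if there is none. -/
def floorIn (M : Finset ℕ) (p : ℕ) : ℕ := {a ∈ M | a ≤ p}.sup id

theorem floorIn_le (M : Finset ℕ) (p : ℕ) : floorIn M p ≤ p :=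
  Finset.sup_le fun _ ha => (mem_filter.1 ha).2

theorem le_floorIn {M : Finset ℕ} {a p : ℕ} (ha : a ∈ M) (hap : a ≤ p) : a ≤ floorIn M p :=
  Finset.le_sup (f := id) (mem_filter.2 ⟨ha, hap⟩)

theorem floorIn_mono (M : Finset ℕ) : Monotone (floorIn M) := fun _ _ h =>
  Finset.sup_mono (monotone_filter_right _ fun _ _ h' => h'.trans h)

theorem floorIn_lt_iff {M : Finset ℕ} {a : ℕ} (ha : a ∈ M) (p : ℕ) :
    floorIn M p < a ↔ p < a := by
  constructor
  · intro h
    by_contra! hap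
    exact absurd (le_floorIn ha hap) (by omega)
  · exact (floorIn_le M p).trans_lt

theorem floorIn_mem {M : Finset ℕ} {a p : ℕ} (ha : a ∈ M) (hap : a ≤ p) : floorIn M p ∈ M := by
  obtain ⟨b, hb, hbp⟩ := exists_mem_eq_sup {a ∈ M | a ≤ p} ⟨a, mem_filter.2 ⟨ha, hap⟩⟩ id
  rw [floorIn, hbp]
  exact (mem_filter.1 hb).1

/-- The minima of the maximal blocks of consecutive integers of `Q`, together with `1`. -/
def segmentStarts (Q : Finset ℕ) : Finset ℕ := insert 1 {i ∈ Q | i - 1 ∉ Q}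

theorem one_mem_segmentStarts (Q : Finset ℕ) : 1 ∈ segmentStarts Q := mem_insert_self _ _

theorem card_filter_insert_erase {α : Type*} [DecidableEq α] (P : α → Prop) [DecidablePred P]
    {S : Finset α} {u v : α} (hu : u ∈ S) (hv : v ∉ S) :
    #{x ∈ insert v (S.erase u) | P x} + (if P u then 1 else 0)
      = #{x ∈ S | P x} + (if P v then 1 else 0) := by
  have hv' : v ∉ {x ∈ S.erase u | P x} := by simp [hv]
  have key : #{x ∈ S.erase u | P x} + (if P u then 1 else 0) = #{x ∈ S | P x} := by
    conv_rhs => rw [← insert_erase hu, filter_insert]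
    split_ifs with h
    · rw [card_insert_of_notMem (by simp)]
    · rfl
  rw [filter_insert]
  split_ifs at key ⊢ with h h'
  all_goals first
    | rw [card_insert_of_notMem hv']; omega
    | omega

theorem card_insert_erase {α : Type*} [DecidableEq α]
    {S : Finset α} {u v : α} (hu : u ∈ S) (hv : v ∉ S) : #(insert v (S.erase u)) = #S := by
  rw [card_insert_of_notMem (by simp [hv]), card_erase_add_one hu]

section

variable {n : ℕ} {π π' : Equiv.Perm (Fin n)} {Q Q' : Finset ℕ} {J : Finset (Fin n)}

/-- Only the initial segments ending just before a block of `Q` constrain the bases. -/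
theorem mem_schubertBases_iff_segmentStarts (hQ : Q ⊆ Icc 1 n) :
    J ∈ schubertBases π (atPositions π Q) ↔ #J = #Q ∧
      ∀ a ∈ segmentStarts Q, #{x ∈ J | position π x < a} ≤ #{q ∈ Q | q < a} := by
  rw [mem_schubertBases_iff hQ]
  refine and_congr_right fun hJ => ⟨fun h a _ => h a, fun h p => ?_⟩
  induction p with
  | zero => simp
  | succ p ih =>
    by_cases hp : p ∈ Q
    · have h₁ : #{q ∈ Q | q < p + 1} = #{q ∈ Q | q < p} + 1 := by
        rw [← card_insert_of_notMem (s := {q ∈ Q | q < p}) (a := p) (by simp)]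
        congr 1
        ext q
        simp only [mem_filter, mem_insert]
        constructor
        · rintro ⟨hq, hqp⟩
          by_cases h : q = p
          · exact .inl h
          · exact .inr ⟨hq, by omega⟩
        · rintro (rfl | ⟨hq, hqp⟩)
          · exact ⟨hp, by omega⟩
          · exact ⟨hq, by omega⟩
      have h₂ : #{x ∈ J | position π x < p + 1} ≤ #{x ∈ J | position π x < p} + 1 := by
        have hone : #{x ∈ J | position π x = p} ≤ 1 := card_le_one.2 fun a ha b hb =>
          position_injective π ((mem_filter.1 ha).2.trans (mem_filter.1 hb).2.symm)
        refine le_trans (card_le_card fun x hx => ?_) ((card_union_le _ _).trans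
          (Nat.add_le_add_left hone _))
        simp only [mem_union, mem_filter] at hx ⊢
        have : position π x < p ∨ position π x = p := by omega
        tauto
      omega
    · by_cases hne : ({q ∈ Q | p < q}).Nonempty
      · obtain ⟨hqQ, hpq⟩ := mem_filter.1 (min'_mem _ hne)
        set q := ({q ∈ Q | p < q}).min' hne with hq
        have hq_min : ∀ r ∈ Q, p < r → q ≤ r := fun r hr hpr =>
          min'_le _ _ (mem_filter.2 ⟨hr, hpr⟩)
        have hqM : q ∈ segmentStarts Q := by
          refine mem_insert_of_mem (mem_filter.2 ⟨hqQ, fun hq' => ?_⟩)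
          by_cases h' : q - 1 = p
          · exact hp (h' ▸ hq')
          · have := hq_min _ hq' (by omega)
            omega
        calc #{x ∈ J | position π x < p + 1}
            ≤ #{x ∈ J | position π x < q} :=
              card_le_card (monotone_filter_right _ fun x _ hx => by omega)
          _ ≤ #{r ∈ Q | r < q} := h q hqM
          _ ≤ #{r ∈ Q | r < p + 1} := by
              refine card_le_card fun r hr => ?_
              obtain ⟨hr, hrq⟩ := mem_filter.1 hr
              refine mem_filter.2 ⟨hr, ?_⟩
              by_contra! hpr
              have := hq_min r hr (by omega)
              omega
      · have hall : {q ∈ Q | q < p + 1} = Q := filter_true_of_mem fun q hq => by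
          by_contra! hpq
          exact hne ⟨q, mem_filter.2 ⟨hq, by omega⟩⟩
        rw [hall, ← hJ]
        exact card_filter_le _ _

/-- The first position of the segment containing `x`, where the segments of `[n]` end just before
the blocks of `Q`. -/
def segmentOf (π : Equiv.Perm (Fin n)) (Q : Finset ℕ) (x : Fin n) : ℕ :=
  floorIn (segmentStarts Q) (position π x)

theorem segmentOf_mem (π : Equiv.Perm (Fin n)) (Q : Finset ℕ) (x : Fin n) :
    segmentOf π Q x ∈ segmentStarts Q :=
  floorIn_mem (one_mem_segmentStarts Q) (one_le_position π x)

theorem segmentOf_lt_iff {a : ℕ} (ha : a ∈ segmentStarts Q) (x : Fin n) :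
    segmentOf π Q x < a ↔ position π x < a := floorIn_lt_iff ha _

theorem segmentOf_le_position (x : Fin n) : segmentOf π Q x ≤ position π x := floorIn_le _ _

theorem one_le_segmentOf (x : Fin n) : 1 ≤ segmentOf π Q x :=
  le_floorIn (one_mem_segmentStarts Q) (one_le_position π x)

theorem schubertBases_eq_of_segmentOf_eq (hQ : Q ⊆ Icc 1 n)
    (h : segmentOf π Q = segmentOf π' Q) :
    schubertBases π (atPositions π Q) = schubertBases π' (atPositions π' Q) := by
  ext J
  rw [mem_schubertBases_iff_segmentStarts hQ, mem_schubertBases_iff_segmentStarts hQ]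
  refine and_congr_right fun _ => forall₂_congr fun a ha => ?_
  simp only [← segmentOf_lt_iff ha, h]

theorem insert_erase_mem_schubertBases (hQ : Q ⊆ Icc 1 n) {x y : Fin n}
    (hJ : J ∈ schubertBases π (atPositions π Q)) (hx : x ∈ J) (hy : y ∉ J)
    (hxy : segmentOf π Q x ≤ segmentOf π Q y) :
    insert y (J.erase x) ∈ schubertBases π (atPositions π Q) := by
  rw [mem_schubertBases_iff_segmentStarts hQ] at hJ ⊢
  refine ⟨(card_insert_erase hx hy).trans hJ.1, fun a ha => ?_⟩
  have h₁ := card_filter_insert_erase (fun z => position π z < a) hx hy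
  have h₂ := hJ.2 a ha
  have h₃ := segmentOf_lt_iff (π := π) ha x
  have h₄ := segmentOf_lt_iff (π := π) ha y
  split_ifs at h₁ <;> omega

/-- If `y` lies in an earlier segment than `x`, some basis contains `x` but not `y` and meets the
initial segment before the segment of `x` in as many elements as possible. -/
theorem exists_mem_schubertBases_tight (hQ : Q ⊆ Icc 1 n) {x y : Fin n}
    (hxy : segmentOf π Q y < segmentOf π Q x) :
    ∃ J ∈ schubertBases π (atPositions π Q), x ∈ J ∧ y ∉ J ∧
      #{z ∈ J | position π z < segmentOf π Q x} = #{q ∈ Q | q < segmentOf π Q x} := by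
  have ha := segmentOf_mem π Q x
  have hax := segmentOf_le_position (π := π) (Q := Q) x
  have hya := (segmentOf_lt_iff ha y).1 hxy
  have h1y := one_le_segmentOf (π := π) (Q := Q) y
  generalize segmentOf π Q x = a at *
  have hxn := position_le π x
  obtain ⟨haQ, haQ'⟩ : a ∈ Q ∧ a - 1 ∉ Q := by
    rcases mem_insert.1 ha with rfl | ha
    · omega
    · exact mem_filter.1 ha
  obtain ⟨v, hv⟩ := exists_position_eq π (p := a) (by omega) (by omega)
  obtain ⟨w, hw⟩ := exists_position_eq π (p := a - 1) (by omega) (by omega)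
  have hvy : v ≠ y := by rintro rfl; omega
  have hvw : v ≠ w := by rintro rfl; omega
  have hxy' : x ≠ y := by rintro rfl; omega
  obtain ⟨K, hK, hyK, hvK, hKa⟩ : ∃ K, (#K = #Q ∧
      ∀ p, #{z ∈ K | position π z < p} ≤ #{q ∈ Q | q < p}) ∧ y ∉ K ∧ v ∈ K ∧
        #{z ∈ K | position π z < a} = #{q ∈ Q | q < a} := by
    have h₀ := (mem_schubertBases_iff hQ).1 (atPositions_mem_schubertBases (π := π) hQ)
    have h₀a := card_filter_atPositions (π := π) hQ a
    have hvQ : v ∈ atPositions π Q := by simpa [hv] using haQ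
    by_cases hyQ : y ∈ atPositions π Q
    · have hwQ : w ∉ atPositions π Q := by simpa [hw] using haQ'
      have hwy : w ≠ y := by rintro rfl; exact hwQ hyQ
      refine ⟨insert w ((atPositions π Q).erase y),
        ⟨(card_insert_erase hyQ hwQ).trans h₀.1, fun p => ?_⟩, by simp [hwy.symm],
        by simp [hvy, hvQ], ?_⟩
      · have h₁ := card_filter_insert_erase (fun z => position π z < p) hyQ hwQ
        have h₂ := h₀.2 p
        split_ifs at h₁ <;> omega
      · have h₁ := card_filter_insert_erase (fun z => position π z < a) hyQ hwQ
        split_ifs at h₁ <;> omega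
    · exact ⟨_, h₀, hyQ, hvQ, h₀a⟩
  by_cases hxK : x ∈ K
  · exact ⟨K, (mem_schubertBases_iff hQ).2 hK, hxK, hyK, hKa⟩
  · refine ⟨insert x (K.erase v), (mem_schubertBases_iff hQ).2
      ⟨(card_insert_erase hvK hxK).trans hK.1, fun p => ?_⟩, mem_insert_self _ _,
      by simp [hyK, hxy'.symm], ?_⟩
    · have h₁ := card_filter_insert_erase (fun z => position π z < p) hvK hxK
      have h₂ := hK.2 p
      split_ifs at h₁ <;> omega
    · have h₁ := card_filter_insert_erase (fun z => position π z < a) hvK hxK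
      split_ifs at h₁ <;> omega

theorem segmentOf_le_iff (hQ : Q ⊆ Icc 1 n) (x y : Fin n) :
    segmentOf π Q x ≤ segmentOf π Q y ↔
      ∀ J ∈ schubertBases π (atPositions π Q), x ∈ J → y ∉ J →
        insert y (J.erase x) ∈ schubertBases π (atPositions π Q) := by
  refine ⟨fun h J hJ hx hy => insert_erase_mem_schubertBases hQ hJ hx hy h, fun h => ?_⟩
  by_contra! hlt
  obtain ⟨J, hJ, hx, hy, hcard⟩ := exists_mem_schubertBases_tight hQ hlt
  have h₁ := ((mem_schubertBases_iff hQ).1 (h J hJ hx hy)).2 (segmentOf π Q x)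
  have h₂ := card_filter_insert_erase (fun z => position π z < segmentOf π Q x) hx hy
  have h₃ := segmentOf_le_position (π := π) (Q := Q) x
  have h₄ := (segmentOf_lt_iff (segmentOf_mem π Q x) y).1 hlt
  split_ifs at h₂ <;> omega

theorem card_segmentOf_lt (x : Fin n) :
    #{z | segmentOf π Q z < segmentOf π Q x} = segmentOf π Q x - 1 := by
  have h₁ := segmentOf_le_position (π := π) (Q := Q) x
  have h₂ := position_le π x
  rw [← card_position_lt π (a := segmentOf π Q x) (by omega)]
  simp only [segmentOf_lt_iff (segmentOf_mem π Q x)]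

theorem segmentOf_eq_of_schubertBases_eq (hQ : Q ⊆ Icc 1 n) (hQ' : Q' ⊆ Icc 1 n)
    (h : schubertBases π (atPositions π Q) = schubertBases π' (atPositions π' Q')) :
    segmentOf π Q = segmentOf π' Q' := by
  have hle (x y : Fin n) :
      segmentOf π Q x ≤ segmentOf π Q y ↔ segmentOf π' Q' x ≤ segmentOf π' Q' y := by
    rw [segmentOf_le_iff hQ, segmentOf_le_iff hQ', h]
  ext x
  have hlt : #{z | segmentOf π Q z < segmentOf π Q x}
      = #{z | segmentOf π' Q' z < segmentOf π' Q' x} := by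
    simp only [← not_le, hle]
  rw [card_segmentOf_lt, card_segmentOf_lt] at hlt
  have h₁ := one_le_segmentOf (π := π) (Q := Q) x
  have h₂ := one_le_segmentOf (π := π') (Q := Q') x
  omega

theorem subset_of_card_filter_lt_eq {Q Q' : Finset ℕ}
    (h : ∀ p, #{q ∈ Q | q < p} = #{q ∈ Q' | q < p}) : Q ⊆ Q' := by
  intro q hq
  by_contra hq'
  have h₁ : #{r ∈ Q | r < q} < #{r ∈ Q | r < q + 1} :=
    card_lt_card ⟨monotone_filter_right _ fun r _ hr => by omega, fun hsub => by
      have := hsub (mem_filter.2 ⟨hq, q.lt_succ_self⟩)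
      simp at this⟩
  have h₂ : #{r ∈ Q' | r < q + 1} ≤ #{r ∈ Q' | r < q} := card_le_card fun r hr => by
    obtain ⟨hr, hrq⟩ := mem_filter.1 hr
    have : r ≠ q := fun h => hq' (h ▸ hr)
    exact mem_filter.2 ⟨hr, by omega⟩
  have h₃ := h q
  have h₄ := h (q + 1)
  omega

theorem positions_eq_of_schubertBases_eq (hQ : Q ⊆ Icc 1 n) (hQ' : Q' ⊆ Icc 1 n)
    (h : schubertBases π (atPositions π Q) = schubertBases π' (atPositions π' Q')) :
    Q = Q' := by
  have hseg := segmentOf_eq_of_schubertBases_eq hQ hQ' h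
  have hmono (R : Finset ℕ) : Monotone fun i : Fin n => floorIn (segmentStarts R) (i + 1) :=
    fun i j hij => floorIn_mono _ (by simpa using hij)
  have hcomp : (fun i : Fin n => floorIn (segmentStarts Q') (i + 1)) ∘ (π'.symm * π)
      = fun i : Fin n => floorIn (segmentStarts Q) (i + 1) := by
    ext i
    have := congrFun hseg (π i)
    simpa [segmentOf, position] using this.symm
  have hfloor : (fun i : Fin n => floorIn (segmentStarts Q) (i + 1))
      = fun i : Fin n => floorIn (segmentStarts Q') (i + 1) :=
    hcomp.symm.trans (Tuple.unique_monotone (σ := π'.symm * π) (τ := 1)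
      (hcomp ▸ hmono Q) (hmono Q'))
  have hπ : schubertBases π' (atPositions π' Q) = schubertBases π' (atPositions π' Q') := by
    rw [← h]
    refine schubertBases_eq_of_segmentOf_eq hQ ?_
    rw [hseg]
    ext x
    exact congrFun hfloor (π'.symm x)
  have hle {R R' : Finset ℕ} (hR : R ⊆ Icc 1 n) (hR' : R' ⊆ Icc 1 n)
      (hRR' : schubertBases π' (atPositions π' R) = schubertBases π' (atPositions π' R'))
      (p : ℕ) : #{q ∈ R | q < p} ≤ #{q ∈ R' | q < p} := by
    have hmem := atPositions_mem_schubertBases (π := π') hR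
    rw [hRR', mem_schubertBases_iff hR'] at hmem
    rw [← card_filter_atPositions (π := π') hR]
    exact hmem.2 p
  have hcard p := le_antisymm (hle hQ hQ' hπ p) (hle hQ' hQ hπ.symm p)
  exact (subset_of_card_filter_lt_eq hcard).antisymm
    (subset_of_card_filter_lt_eq fun p => (hcard p).symm)

end

theorem prod_factorial_diffList (N : ℕ) :
    ∀ (L : List ℕ) (prev : ℕ), (prev :: L).Pairwise (· ≤ ·) → (∀ a ∈ prev :: L, a ≤ N) →
      ((diffList N prev L).map Nat.factorial).prod =
        ∏ a ∈ (prev :: L).toFinset,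
          (#{p ∈ Ico prev N | floorIn (prev :: L).toFinset p = a}).factorial
  | [], prev, _, _ => by
    have h : {p ∈ Ico prev N | floorIn {prev} p = prev} = Ico prev N :=
      filter_true_of_mem fun p hp =>
        have hp' := (mem_Ico.1 hp).1
        mem_singleton.1 (floorIn_mem (mem_singleton_self prev) hp')
    simp [diffList, h]
  | m :: L, prev, hL, hN => by
    have ih := prod_factorial_diffList N L m (List.pairwise_cons.1 hL).2
      (fun a ha => hN a (List.mem_cons_of_mem _ ha))
    have hm : ∀ a ∈ (m :: L).toFinset, m ≤ a := by
      intro a ha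
      rcases List.mem_cons.1 (List.mem_toFinset.1 ha) with rfl | ha
      · exact le_rfl
      · exact (List.pairwise_cons.1 (List.pairwise_cons.1 hL).2).1 a ha
    have hprev : prev ≤ m := (List.pairwise_cons.1 hL).1 m (by simp)
    have hmN : m ≤ N := hN m (by simp)
    simp only [diffList, List.map_cons, List.prod_cons]
    rw [ih]
    rcases hprev.eq_or_lt with rfl | hlt
    · simp
    have hprev_notMem : prev ∉ (m :: L).toFinset := fun h => by
      have := hm _ h
      omega
    rw [List.toFinset_cons (a := prev), prod_insert hprev_notMem]
    set M := (m :: L).toFinset with hM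
    have hmM : m ∈ M := by simp [hM]
    have hlow {p : ℕ} (h₁ : prev ≤ p) (h₂ : p < m) : floorIn (insert prev M) p = prev := by
      rcases mem_insert.1 (floorIn_mem (mem_insert_self prev M) h₁) with h | h
      · exact h
      · have := hm _ h
        have := floorIn_le (insert prev M) p
        omega
    have hhigh {p : ℕ} (h : m ≤ p) : floorIn (insert prev M) p = floorIn M p := by
      refine le_antisymm ?_ (Finset.sup_mono (filter_subset_filter _ (subset_insert _ _)))
      rcases mem_insert.1 (floorIn_mem (mem_insert_of_mem (b := prev) hmM) h) with h' | h'
      · rw [h']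
        exact hprev.trans (le_floorIn hmM h)
      · exact le_floorIn h' (floorIn_le _ _)
    congr 1
    · rw [← Nat.card_Ico]
      congr 2
      ext p
      simp only [mem_filter, mem_Ico]
      constructor
      · exact fun h => ⟨⟨h.1, h.2.trans_le hmN⟩, hlow h.1 h.2⟩
      · rintro ⟨⟨h₁, _⟩, h₂⟩
        refine ⟨h₁, ?_⟩
        by_contra! h₃
        have := le_floorIn (mem_insert_of_mem (b := prev) hmM) h₃
        omega
    · refine prod_congr rfl fun a ha => ?_
      congr 2
      ext p
      simp only [mem_filter, mem_Ico]
      constructor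
      · rintro ⟨⟨h₁, h₂⟩, h₃⟩
        exact ⟨⟨by omega, h₂⟩, (hhigh h₁).trans h₃⟩
      · rintro ⟨⟨h₁, h₂⟩, h₃⟩
        have hmp : m ≤ p := by
          by_contra! hpm
          rw [hlow h₁ hpm] at h₃
          exact hprev_notMem (h₃ ▸ ha)
        exact ⟨⟨hmp, h₂⟩, (hhigh hmp).symm.trans h₃⟩

section

variable {n : ℕ} {π π' : Equiv.Perm (Fin n)} {Q Q' : Finset ℕ} {J : Finset (Fin n)}

theorem prod_factorial_diffList_blockMinima (hQ : Q ⊆ Icc 1 n) :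
    ((diffList (n + 1) 1 (blockMinima Q)).map Nat.factorial).prod =
      ∏ a ∈ segmentStarts Q,
        (#{i : Fin n | floorIn (segmentStarts Q) (i + 1) = a}).factorial := by
  have hmem {a : ℕ} (ha : a ∈ blockMinima Q) : a ∈ Icc 1 n :=
    hQ (mem_filter.1 ((mem_sort _).1 ha)).1
  have hset : (1 :: blockMinima Q).toFinset = segmentStarts Q := by
    rw [List.toFinset_cons, blockMinima, sort_toFinset, segmentStarts]
  rw [prod_factorial_diffList, hset]
  · refine prod_congr rfl fun a _ => ?_
    have h := card_filter_position (Equiv.refl (Fin n))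
      (Q := {p ∈ Ico 1 (n + 1) | floorIn (segmentStarts Q) p = a}) fun p hp => by
        have := mem_Ico.1 (mem_filter.1 hp).1
        exact mem_Icc.2 ⟨this.1, by omega⟩
    rw [← h]
    congr 2
    ext i
    simp [position]
  · exact List.pairwise_cons.2 ⟨fun a ha => (mem_Icc.1 (hmem ha)).1, pairwise_sort _ _⟩
  · intro a ha
    rcases List.mem_cons.1 ha with rfl | ha
    · omega
    · have := (mem_Icc.1 (hmem ha)).2
      omega

theorem card_segmentOf_eq (hQ : Q ⊆ Icc 1 n) (π : Equiv.Perm (Fin n)) :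
    #{π' : Equiv.Perm (Fin n) | segmentOf π' Q = segmentOf π Q} =
      ((diffList (n + 1) 1 (blockMinima Q)).map Nat.factorial).prod := by
  set f : Fin n → ℕ := fun i => floorIn (segmentStarts Q) (i + 1) with hf
  have hstab : Fintype.card {σ : Equiv.Perm (Fin n) // f ∘ σ = f} =
      #{σ : Equiv.Perm (Fin n) | f ∘ σ = f} := Fintype.card_subtype _
  have himage : univ.image f ⊆ segmentStarts Q := fun a ha => by
    obtain ⟨i, _, rfl⟩ := mem_image.1 ha
    exact floorIn_mem (one_mem_segmentStarts Q) (by omega)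
  have hcard := DomMulAct.stabilizer_card' f
  rw [hstab, prod_subset himage] at hcard
  · rw [prod_factorial_diffList_blockMinima hQ]
    simp only [Fintype.card_subtype] at hcard
    rw [← hcard]
    refine card_nbij' (fun τ => τ.symm * π) (fun σ => π * σ.symm) ?_ ?_ ?_ ?_
    · intro τ hτ
      have hτ' : segmentOf τ Q = segmentOf π Q := by simpa using hτ
      have : f ∘ (τ.symm * π) = f := by
        ext i
        simpa [segmentOf, position, hf] using congrFun hτ' (π i)
      simpa using this
    · intro σ hσ
      have hσ' : f ∘ σ = f := by simpa using hσ
      have : segmentOf (π * σ.symm) Q = segmentOf π Q := by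
        ext x
        exact congrFun hσ' (π.symm x)
      simpa using this
    · intro τ _
      ext x
      simp [Equiv.Perm.mul_def]
    · intro σ _
      ext x
      simp [Equiv.Perm.mul_def]
  · intro a _ ha
    have : IsEmpty {i // f i = a} :=
      ⟨fun i => ha (mem_image.2 ⟨i.1, mem_univ _, i.2⟩)⟩
    simp

/-- The Schubert matroids with a prescribed set of positions are counted by `binomDelta`. -/
theorem card_image_schubertBases (hQ : Q ⊆ Icc 1 n) :
    #(univ.image fun π : Equiv.Perm (Fin n) => schubertBases π (atPositions π Q))
      = binomDelta n Q := by
  have h := card_eq_sum_card_image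
    (fun π : Equiv.Perm (Fin n) => schubertBases π (atPositions π Q)) univ
  rw [sum_const_nat (m := ((diffList (n + 1) 1 (blockMinima Q)).map Nat.factorial).prod),
    card_univ, Fintype.card_perm, Fintype.card_fin] at h
  · rw [binomDelta, h, Nat.mul_div_cancel]
    refine List.prod_pos fun a ha => ?_
    obtain ⟨b, _, rfl⟩ := List.mem_map.1 ha
    exact b.factorial_pos
  · intro B hB
    obtain ⟨π, _, rfl⟩ := mem_image.1 hB
    rw [← card_segmentOf_eq hQ π]
    congr 1
    ext τ
    simp only [mem_filter, mem_univ, true_and]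
    exact ⟨segmentOf_eq_of_schubertBases_eq hQ hQ, schubertBases_eq_of_segmentOf_eq hQ⟩

theorem forall_notMem_schubertBases_iff (hQ : Q ⊆ Icc 1 n) (hne : Q.Nonempty) (x : Fin n) :
    (∀ J ∈ schubertBases π (atPositions π Q), x ∉ J) ↔ position π x < Q.min' hne := by
  constructor
  · intro h
    by_contra! hle
    have h₀ := atPositions_mem_schubertBases (π := π) hQ
    have hx := h _ h₀
    have hmin := Q.min'_mem hne
    obtain ⟨h1, hn⟩ := mem_Icc.1 (hQ hmin)
    obtain ⟨v, hv⟩ := exists_position_eq π h1 hn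
    have hvQ : v ∈ atPositions π Q := by rwa [mem_atPositions, hv]
    refine h _ ?_ (mem_insert_self x ((atPositions π Q).erase v))
    exact insert_erase_mem_schubertBases hQ h₀ hvQ hx (floorIn_mono _ (by omega))
  · intro hlt J hJ hx
    have h₁ := ((mem_schubertBases_iff hQ).1 hJ).2 (Q.min' hne)
    have h₂ : {q ∈ Q | q < Q.min' hne} = ∅ :=
      filter_false_of_mem fun q hq => (Q.min'_le q hq).not_gt
    rw [h₂, card_empty] at h₁
    have h₃ : x ∈ {z ∈ J | position π z < Q.min' hne} := mem_filter.2 ⟨hx, hlt⟩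
    exact absurd (card_pos.2 ⟨x, h₃⟩) (by omega)

theorem card_loops (hQ : Q ⊆ Icc 1 n) (hne : Q.Nonempty) :
    #{x : Fin n | ∀ J ∈ schubertBases π (atPositions π Q), x ∉ J} = Q.min' hne - 1 := by
  have hmin := mem_Icc.1 (hQ (Q.min'_mem hne))
  simp only [forall_notMem_schubertBases_iff hQ hne]
  exact card_position_lt π (by omega)

theorem exists_subset_card_eq_upper {α : Type*} [DecidableEq α] (f : α → ℕ) (R : Finset α) :
    ∀ m ≤ #R, ∃ J ⊆ R, #J = m ∧ ∀ x ∈ J, ∀ y ∈ R, f x < f y → y ∈ J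
  | 0, _ => ⟨∅, empty_subset _, rfl, by simp⟩
  | m + 1, hm => by
    obtain ⟨J, hJR, hJ, hup⟩ := exists_subset_card_eq_upper f R m (by omega)
    have hne : (R \ J).Nonempty := by
      rw [← card_pos, card_sdiff_of_subset hJR]
      omega
    obtain ⟨z, hz, hmax⟩ := exists_max_image (R \ J) f hne
    obtain ⟨hzR, hzJ⟩ := mem_sdiff.1 hz
    refine ⟨insert z J, insert_subset hzR hJR, by rw [card_insert_of_notMem hzJ, hJ], ?_⟩
    intro x hx y hy hxy
    by_contra hyJ
    rw [mem_insert, not_or] at hyJ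
    rcases mem_insert.1 hx with rfl | hx
    · exact (hmax y (mem_sdiff.2 ⟨hy, hyJ.2⟩)).not_gt hxy
    · exact hyJ.2 (hup x hx y hy hxy)

theorem exists_mem_schubertBases_subset (hQ : Q ⊆ Icc 1 n) (hne : Q.Nonempty)
    {R : Finset (Fin n)} (hR : Q.max' hne ≤ #R) :
    ∃ J ∈ schubertBases π (atPositions π Q), J ⊆ R := by
  have hQmax : Q ⊆ Icc 1 (Q.max' hne) := fun q hq =>
    mem_Icc.2 ⟨(mem_Icc.1 (hQ hq)).1, Q.le_max' q hq⟩
  have hQcard : #Q ≤ Q.max' hne := by simpa using card_le_card hQmax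
  obtain ⟨J, hJR, hJ, hup⟩ := exists_subset_card_eq_upper (position π) R #Q (by omega)
  refine ⟨J, (mem_schubertBases_iff hQ).2 ⟨hJ, fun p => ?_⟩, hJR⟩
  by_cases hlow : ∃ x ∈ J, position π x < p
  · obtain ⟨x, hx, hxp⟩ := hlow
    have hxn := position_le π x
    have hx1 := one_le_position π x
    have h₁ := card_filter_add_card_filter_not (s := J) (fun z => position π z < p)
    have h₂ := card_filter_add_card_filter_not (s := Q) (· < p)
    have h₃ := card_filter_add_card_filter_not (s := R) (fun z => position π z < p)
    have h₄ : #{z ∈ R | ¬ position π z < p} ≤ #{z ∈ J | ¬ position π z < p} :=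
      card_le_card fun z hz => by
        obtain ⟨hz, hzp⟩ := mem_filter.1 hz
        exact mem_filter.2 ⟨hup x hx z hz (by omega), hzp⟩
    have h₅ : #{z ∈ R | position π z < p} ≤ p - 1 := by
      rw [← Nat.card_Ico]
      refine card_le_card_of_injOn (position π) (fun z hz => ?_) (position_injective π).injOn
      exact mem_coe.2 (mem_Ico.2 ⟨one_le_position π z, (mem_filter.1 hz).2⟩)
    have h₆ : #{q ∈ Q | ¬ q < p} ≤ Q.max' hne + 1 - p := by
      rw [← Nat.card_Ico]
      refine card_le_card fun q hq => ?_
      obtain ⟨hq, hqp⟩ := mem_filter.1 hq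
      have := Q.le_max' q hq
      exact mem_Ico.2 ⟨by omega, by omega⟩
    omega
  · rw [filter_false_of_mem fun x hx hxp => hlow ⟨x, hx, hxp⟩]
    simp

theorem isLeast_cogirth (hQ : Q ⊆ Icc 1 n) (hne : Q.Nonempty) :
    IsLeast {c : ℕ | ∃ C : Finset (Fin n), #C = c ∧
      ∀ J ∈ schubertBases π (atPositions π Q), ¬ J ⊆ Cᶜ} (n + 1 - Q.max' hne) := by
  have hmax := mem_Icc.1 (hQ (Q.max'_mem hne))
  constructor
  · refine ⟨({x | position π x < Q.max' hne} : Finset (Fin n))ᶜ, ?_, fun J hJ hsub => ?_⟩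
    · rw [card_compl, card_position_lt π (by omega), Fintype.card_fin]
      omega
    · rw [compl_compl] at hsub
      obtain ⟨h₁, h₂⟩ := (mem_schubertBases_iff hQ).1 hJ
      have h₃ := h₂ (Q.max' hne)
      rw [filter_true_of_mem fun x hx => (mem_filter.1 (hsub hx)).2, h₁] at h₃
      have h₄ : #{q ∈ Q | q < Q.max' hne} < #Q := card_lt_card
        (filter_ssubset.2 ⟨_, Q.max'_mem hne, lt_irrefl _⟩)
      omega
  · rintro c ⟨C, rfl, hC⟩
    by_contra! hlt
    obtain ⟨J, hJ, hJC⟩ := exists_mem_schubertBases_subset (π := π) hQ hne (R := Cᶜ) (by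
      rw [card_compl, Fintype.card_fin]
      omega)
    exact hC J hJ hJC

end

/-- For `m ≥ 1`, `ℓ ≥ 0` and `ℓ + 1 ≤ k ≤ n`, the number of distinct
Schubert matroids on `[n]` (distinct base families `B_{I,π}`) of rank `m`, with exactly
`ℓ` loops, and with cogirth exactly `n + 1 - k`, equals
`Σ_{I ⊆ {ℓ+1,…,k}, ℓ+1 ∈ I, k ∈ I, |I| = m} binom(n, ΔI)`. -/
theorem card_schubert_rank_loops_cogirth (n m k ℓ : ℕ) (hm : 1 ≤ m)
    (hℓk : ℓ + 1 ≤ k) (hkn : k ≤ n) :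
    {B : Finset (Finset (Fin n)) |
        (∃ (I : Finset (Fin n)) (π : Equiv.Perm (Fin n)),
            I.card = m ∧ B = schubertBases π I)
        ∧ (Finset.univ.filter (fun x : Fin n => ∀ J ∈ B, x ∉ J)).card = ℓ
        ∧ IsLeast {c : ℕ | ∃ C : Finset (Fin n), C.card = c ∧ ∀ J ∈ B, ¬ J ⊆ Cᶜ}
            (n + 1 - k)}.ncard
      = ∑ I ∈ (Finset.Icc (ℓ + 1) k).powerset.filter
            (fun I => ℓ + 1 ∈ I ∧ k ∈ I ∧ I.card = m),
          binomDelta n I := by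
  classical
  set 𝒬 := (Icc (ℓ + 1) k).powerset.filter (fun I => ℓ + 1 ∈ I ∧ k ∈ I ∧ #I = m)
  have hmem {Q : Finset ℕ} : Q ∈ 𝒬 ↔ Q ⊆ Icc (ℓ + 1) k ∧ ℓ + 1 ∈ Q ∧ k ∈ Q ∧ #Q = m := by
    simp [𝒬]
  have hsub {Q : Finset ℕ} (hQ : Q ∈ 𝒬) : Q ⊆ Icc 1 n :=
    (hmem.1 hQ).1.trans (Icc_subset_Icc (by omega) hkn)
  rw [← sum_congr rfl fun Q hQ => card_image_schubertBases (hsub hQ), ← card_biUnion,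
    ← Set.ncard_coe_finset]
  · congr 1
    ext B
    simp only [Set.mem_ofPred_eq, coe_biUnion, Set.mem_iUnion, mem_coe, coe_image, coe_univ,
      Set.image_univ, Set.mem_range, exists_prop]
    constructor
    · rintro ⟨⟨I, π, hI, rfl⟩, hloops, hcogirth⟩
      set Q := I.image (position π) with hQ_def
      have hQ : Q ⊆ Icc 1 n := image_subset_iff.2 fun x _ =>
        mem_Icc.2 ⟨one_le_position π x, position_le π x⟩
      have hIQ : I = atPositions π Q := by
        ext x
        simp [hQ_def, (position_injective π).eq_iff]
      have hQm : #Q = m := (card_image_of_injective _ (position_injective π)).trans hI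
      have hne : Q.Nonempty := card_pos.1 (by omega)
      rw [hIQ] at hloops hcogirth ⊢
      rw [card_loops hQ hne] at hloops
      have hmin := mem_Icc.1 (hQ (Q.min'_mem hne))
      have hmax := mem_Icc.1 (hQ (Q.max'_mem hne))
      have hmax' := hcogirth.unique (isLeast_cogirth hQ hne)
      have hℓ : Q.min' hne = ℓ + 1 := by omega
      have hk : Q.max' hne = k := by omega
      exact ⟨Q, hmem.2 ⟨fun q hq => mem_Icc.2 ⟨hℓ ▸ Q.min'_le q hq, hk ▸ Q.le_max' q hq⟩,
        hℓ ▸ Q.min'_mem hne, hk ▸ Q.max'_mem hne, hQm⟩, π, rfl⟩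
    · rintro ⟨Q, hQ𝒬, π, rfl⟩
      have hQ := hsub hQ𝒬
      obtain ⟨hQℓk, hℓ, hk, hQm⟩ := hmem.1 hQ𝒬
      have hne : Q.Nonempty := ⟨k, hk⟩
      have hmin : Q.min' hne = ℓ + 1 := le_antisymm (Q.min'_le _ hℓ)
        (mem_Icc.1 (hQℓk (Q.min'_mem hne))).1
      have hmax : Q.max' hne = k := le_antisymm (mem_Icc.1 (hQℓk (Q.max'_mem hne))).2
        (Q.le_max' _ hk)
      refine ⟨⟨_, π, (card_filter_position π hQ).trans hQm, rfl⟩, ?_, ?_⟩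
      · rw [card_loops hQ hne]
        omega
      · rw [← hmax]
        exact isLeast_cogirth hQ hne
  · intro Q hQ Q' hQ' hQQ'
    rw [Function.onFun, disjoint_left]
    intro B hB hB'
    obtain ⟨π, _, rfl⟩ := mem_image.1 hB
    obtain ⟨π', _, h⟩ := mem_image.1 hB'
    exact hQQ' (positions_eq_of_schubertBases_eq (hsub hQ) (hsub hQ') h.symm)
end

section
/- Let 1 ≤ k ≤ n and 0 ≤ m ≤ k − 1. The number of distinct loopless Schubert matroids on ground set [n] of rank m + 1 and cogirth greater than n − k (i.e. distinct base families B_{I,π} over all I ⊆ [n] with |I| = m+1 and π ∈ S_n, such that every element of [n] lies in some member of the family, and every subset of [n] of cardinality at least k contains a member of the family) equals Σ_{I ⊆ {1,…,k}, 1 ∈ I, |I| = m+1} binom(n, ΔI), which is the coefficient of x^m in the Chow polynomial of the uniform matroid U_{k,n}. -/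
open Finset

lemma forall₂_le_iff_countP {α : Type*} (g : α → ℕ) (l₁ l₂ : List α)
    (h₁ : l₁.Pairwise fun a b => g a ≤ g b) (h₂ : l₂.Pairwise fun a b => g a ≤ g b) :
    List.Forall₂ (fun a b => g a ≤ g b) l₁ l₂ ↔
      l₂.length = l₁.length ∧
        ∀ p, l₂.countP (fun a => g a ≤ p) ≤ l₁.countP (fun a => g a ≤ p) := by
  induction l₁ generalizing l₂ with
  | nil => cases l₂ <;> simp
  | cons a l₁ ih =>
    cases l₂ with
    | nil => simp
    | cons b l₂ =>
      rw [List.pairwise_cons] at h₁ h₂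
      rw [List.forall₂_cons, ih l₂ h₁.2 h₂.2]
      have hz : ∀ p, p < g b → l₂.countP (fun a => g a ≤ p) = 0 := fun p hp => by
        rw [List.countP_eq_zero]
        intro c hc
        have := h₂.1 c hc
        simp; omega
      constructor
      · rintro ⟨hab, hl, hc⟩
        refine ⟨by simp [hl], fun p => ?_⟩
        have := hc p
        simp only [List.countP_cons, decide_eq_true_eq]
        split_ifs <;> omega
      · rintro ⟨hl, hc⟩
        have hab : g a ≤ g b := by
          by_contra hlt
          have h0 : (a :: l₁).countP (fun a => g a ≤ g b) = 0 := by
            rw [List.countP_eq_zero]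
            intro c hc
            rcases List.mem_cons.1 hc with rfl | hc
            · simpa using hlt
            · have := h₁.1 c hc
              simp; omega
          have := hc (g b)
          rw [h0] at this
          simp at this
        refine ⟨hab, by simpa using hl, fun p => ?_⟩
        have := hc p
        simp only [List.countP_cons, decide_eq_true_eq] at this
        rcases lt_or_ge p (g b) with hp | hp
        · rw [hz p hp]; omega
        · rw [if_pos hp, if_pos (hab.trans hp)] at this
          omega

/-- The one-based position of an element in the order `≤_π`. -/
def posEmb {n : ℕ} (π : Equiv.Perm (Fin n)) : Fin n ↪ ℕ :=
  ⟨fun x => (π.symm x).val + 1, fun x y h => π.symm.injective (Fin.ext (by simpa using h))⟩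

/-- `K` lies componentwise above `I`, expressed by counting initial segments. -/
def Dominates (I K : Finset ℕ) : Prop :=
  #K = #I ∧ ∀ p, #{j ∈ K | j ≤ p} ≤ #{j ∈ I | j ≤ p}

open Classical in
/-- The bases of the Schubert matroid whose defining set has position set `I`. -/
noncomputable def positionBases {n : ℕ} (I : Finset ℕ) (π : Equiv.Perm (Fin n)) :
    Finset (Finset (Fin n)) :=
  {J | Dominates I (J.map (posEmb π))}

lemma mem_positionBases {n : ℕ} {I : Finset ℕ} {π : Equiv.Perm (Fin n)} {J : Finset (Fin n)} :
    J ∈ positionBases I π ↔ Dominates I (J.map (posEmb π)) := by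
  simp [positionBases]

lemma card_filter_map_posEmb {n : ℕ} (π : Equiv.Perm (Fin n)) (J : Finset (Fin n)) (p : ℕ) :
    #{j ∈ J.map (posEmb π) | j ≤ p} = (piSort π J).countP (fun a => posEmb π a ≤ p) := by
  rw [Finset.filter_map, Finset.card_map, Finset.card_def, Finset.filter_val,
    ← Multiset.countP_eq_card_filter, ← Finset.sort_eq J (piLE π), Multiset.coe_countP]
  rfl

lemma schubertBases_eq_positionBases {n : ℕ} (π : Equiv.Perm (Fin n)) (I : Finset (Fin n)) :
    schubertBases π I = positionBases (I.map (posEmb π)) π := by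
  ext J
  have hle : piLE π = fun a b => posEmb π a ≤ posEmb π b := by
    ext a b
    exact Nat.succ_le_succ_iff.symm
  have hs : ∀ K : Finset (Fin n),
      (piSort π K).Pairwise fun a b => posEmb π a ≤ posEmb π b := fun K =>
    (Finset.pairwise_sort K (piLE π)).imp fun {a b} h => by rwa [hle] at h
  rw [mem_positionBases, schubertBases, Finset.mem_filter, piDom, hle,
    forall₂_le_iff_countP _ _ _ (hs I) (hs J)]
  simp only [Dominates, card_filter_map_posEmb, Finset.card_map, piSort, Finset.length_sort]
  simp

lemma card_filter_insert_erase_s14 {α : Type*} [DecidableEq α] {K : Finset α} {a b : α}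
    (ha : a ∈ K) (hb : b ∉ K) (q : α → Prop) [DecidablePred q] :
    #{j ∈ insert b (K.erase a) | q j} + (if q a then 1 else 0) =
      #{j ∈ K | q j} + (if q b then 1 else 0) := by
  rw [Finset.card_filter, Finset.card_filter,
    Finset.sum_insert (fun h => hb (Finset.mem_of_mem_erase h)),
    ← Finset.sum_erase_add K _ ha]
  omega

lemma card_insert_erase_s14 {α : Type*} [DecidableEq α] {K : Finset α} {a b : α}
    (ha : a ∈ K) (hb : b ∉ K) : #(insert b (K.erase a)) = #K := by
  simpa using card_filter_insert_erase_s14 ha hb (fun _ => True)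

/-- The minima of the maximal blocks of consecutive integers of `I`. -/
def blockStarts (I : Finset ℕ) : Finset ℕ := I.filter fun i => i - 1 ∉ I

/-- The largest block minimum of `I` that is at most `j`. -/
def blockStart (I : Finset ℕ) (j : ℕ) : ℕ := ((blockStarts I).filter (· ≤ j)).sup id

section BlockStart

variable {I : Finset ℕ} {j p q v : ℕ}

lemma blockStart_le : blockStart I j ≤ j :=
  Finset.sup_le fun _ h => (Finset.mem_filter.1 h).2

lemma le_blockStart (hv : v ∈ blockStarts I) (h : v ≤ j) : v ≤ blockStart I j :=
  Finset.le_sup (f := id) (Finset.mem_filter.2 ⟨hv, h⟩)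

lemma blockStart_mono (h : p ≤ q) : blockStart I p ≤ blockStart I q :=
  Finset.sup_mono fun i hi => by
    rw [Finset.mem_filter] at hi ⊢
    exact ⟨hi.1, hi.2.trans h⟩

lemma one_mem_blockStarts (h0 : 0 ∉ I) (h1 : 1 ∈ I) : 1 ∈ blockStarts I := by
  simp [blockStarts, h0, h1]

lemma blockStart_mem (h0 : 0 ∉ I) (h1 : 1 ∈ I) (hj : 1 ≤ j) :
    blockStart I j ∈ blockStarts I := by
  have hne : ((blockStarts I).filter (· ≤ j)).Nonempty :=
    ⟨1, Finset.mem_filter.2 ⟨one_mem_blockStarts h0 h1, hj⟩⟩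
  obtain ⟨i, hi, h⟩ := Finset.exists_mem_eq_sup _ hne id
  rw [blockStart, h]
  exact (Finset.mem_filter.1 hi).1

lemma one_le_blockStart (h0 : 0 ∉ I) (h1 : 1 ∈ I) (hj : 1 ≤ j) : 1 ≤ blockStart I j :=
  le_blockStart (one_mem_blockStarts h0 h1) hj

lemma blockStart_lt_iff (hv : v ∈ blockStarts I) : blockStart I j < v ↔ j < v := by
  refine ⟨fun h => ?_, fun h => blockStart_le.trans_lt h⟩
  by_contra hle
  exact absurd (le_blockStart hv (not_lt.1 hle)) (not_le.2 h)

lemma blockStart_eq_self (hv : v ∈ blockStarts I) : blockStart I v = v :=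
  le_antisymm blockStart_le (le_blockStart hv le_rfl)

/-- Within the part starting at a block minimum, `I` is an initial segment. -/
lemma notMem_of_blockStart_eq (hp : p ∉ I) (hpq : p ≤ q)
    (h : blockStart I q ≤ blockStart I p) : q ∉ I := by
  induction q, hpq using Nat.le_induction with
  | base => exact hp
  | succ q hpq ih =>
    intro hq
    have hq' := ih ((blockStart_mono (Nat.le_succ q)).trans h)
    have hs : q + 1 ∈ blockStarts I := by simp [blockStarts, hq, hq']
    have := blockStart_eq_self hs
    have := blockStart_le (I := I) (j := p)
    omega

/-- Domination only has to be tested on the unions of the first few parts. -/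
lemma dominates_iff_blockStart (h0 : 0 ∉ I) (h1 : 1 ∈ I) {K : Finset ℕ} (hK : 0 ∉ K) :
    Dominates I K ↔
      #K = #I ∧ ∀ v, #{j ∈ K | blockStart I j ≤ v} ≤ #{j ∈ I | blockStart I j ≤ v} := by
  refine and_congr_right fun hcard => ⟨fun h v => ?_, fun h p => ?_⟩
  · by_cases hall : ∀ j ∈ I, blockStart I j ≤ v
    · rw [Finset.filter_true_of_mem hall, ← hcard]
      exact Finset.card_filter_le _ _
    · push Not at hall
      obtain ⟨i, -, hi⟩ := hall
      have hi1 : 1 ≤ i := by have := blockStart_le (I := I) (j := i); omega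
      set P : ℕ → Prop := fun j => v < blockStart I j
      have hex : ∃ j, P j := ⟨i, hi⟩
      classical
      have key : ∀ j, blockStart I j ≤ v ↔ j ≤ Nat.find hex - 1 := fun j => by
        have hpos : 0 < Nat.find hex := by
          have h2 : v < blockStart I (Nat.find hex) := Nat.find_spec hex
          have := blockStart_le (I := I) (j := Nat.find hex)
          omega
        constructor
        · intro hj
          by_contra hlt
          have h2 : v < blockStart I (Nat.find hex) := Nat.find_spec hex
          have := blockStart_mono (I := I) (p := Nat.find hex) (q := j) (by omega)
          omega
        · intro hj
          exact not_lt.1 (Nat.find_min hex (m := j) (by omega))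
      simp only [key]
      exact h _
  · rcases Nat.eq_zero_or_pos p with rfl | hp
    · have : #{j ∈ K | j ≤ 0} = 0 := by
        rw [Finset.card_eq_zero, Finset.filter_eq_empty_iff]
        rintro j hj hj0
        exact hK (Nat.le_zero.1 hj0 ▸ hj)
      omega
    set s := blockStart I p with hs
    have hsm := blockStart_mem h0 h1 hp
    have hs1 := one_le_blockStart h0 h1 hp
    have hsp : s ≤ p := blockStart_le
    by_cases hall : Finset.Icc s p ⊆ I
    · have hsplit : ∀ L : Finset ℕ, #{j ∈ L | j ≤ p} =
          #{j ∈ L | blockStart I j ≤ s - 1} + #(L ∩ Finset.Icc s p) := fun L => by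
        rw [← Finset.card_union_of_disjoint]
        · congr 1
          ext j
          have := blockStart_lt_iff (j := j) hsm
          simp only [Finset.mem_filter, Finset.mem_union, Finset.mem_inter, Finset.mem_Icc]
          constructor
          · rintro ⟨hj, hjp⟩
            rcases lt_or_ge j s with hjs | hjs
            · exact Or.inl ⟨hj, by omega⟩
            · exact Or.inr ⟨hj, hjs, hjp⟩
          · rintro (⟨hj, hjs⟩ | ⟨hj, -, hjp⟩)
            · exact ⟨hj, by omega⟩
            · exact ⟨hj, hjp⟩
        · rw [Finset.disjoint_left]
          intro j
          have := blockStart_lt_iff (j := j) hsm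
          simp only [Finset.mem_filter, Finset.mem_inter, Finset.mem_Icc]
          rintro ⟨-, ha⟩ ⟨-, hb, -⟩
          omega
      rw [hsplit K, hsplit I, Finset.inter_eq_right.2 hall]
      exact Nat.add_le_add (h _) (Finset.card_le_card Finset.inter_subset_right)
    · obtain ⟨q, hq, hqI⟩ := Finset.not_subset.1 hall
      rw [Finset.mem_Icc] at hq
      calc #{j ∈ K | j ≤ p} ≤ #{j ∈ K | blockStart I j ≤ s} :=
            Finset.card_le_card (Finset.monotone_filter_right _ fun j _ hj => blockStart_mono hj)
        _ ≤ #{j ∈ I | blockStart I j ≤ s} := h s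
        _ ≤ #{j ∈ I | j ≤ p} := by
            refine Finset.card_le_card fun j hj => ?_
            rw [Finset.mem_filter] at hj ⊢
            refine ⟨hj.1, ?_⟩
            by_contra hlt
            exact notMem_of_blockStart_eq hqI (by omega)
              (hj.2.trans (le_blockStart hsm hq.1)) hj.1

lemma Dominates.insert_erase (h0 : 0 ∉ I) (h1 : 1 ∈ I) {K : Finset ℕ} (hK : 0 ∉ K)
    (h : Dominates I K) {a b : ℕ} (ha : a ∈ K) (hb : b ∉ K) (hb0 : b ≠ 0)
    (hab : blockStart I a ≤ blockStart I b) : Dominates I (insert b (K.erase a)) := by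
  rw [dominates_iff_blockStart h0 h1 hK] at h
  rw [dominates_iff_blockStart h0 h1 (by simp [hK, hb0.symm])]
  refine ⟨(card_insert_erase_s14 ha hb).trans h.1, fun v => ?_⟩
  have h2 := card_filter_insert_erase_s14 ha hb (fun j => blockStart I j ≤ v)
  have h3 := h.2 v
  split_ifs at h2 <;> omega

lemma dominates_self : Dominates I I := ⟨rfl, fun _ => le_rfl⟩

/-- A position in a later part can be exchanged for one in an earlier part in a way that
destroys domination. -/
lemma exists_dominates_not_insert_erase (h0 : 0 ∉ I) (h1 : 1 ∈ I) {x y : ℕ} (hx : x ≠ 0)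
    (hxy : blockStart I x < blockStart I y) :
    ∃ K, K ⊆ insert y (insert (blockStart I y - 1) I) ∧ Dominates I K ∧ y ∈ K ∧ x ∉ K ∧
      ¬ Dominates I (insert x (K.erase y)) := by
  have hy : 1 ≤ y := by have := blockStart_le (I := I) (j := y); omega
  set v := blockStart I y with hv
  have hvm : v ∈ blockStarts I := blockStart_mem h0 h1 hy
  have hvy : v ≤ y := blockStart_le
  have hxv : x < v := (blockStart_lt_iff hvm).1 hxy
  have hvI : v ∈ I := (Finset.mem_filter.1 hvm).1
  have hvI' : v - 1 ∉ I := (Finset.mem_filter.1 hvm).2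
  obtain ⟨L, hLs, hL, hxL, hvL, hLc⟩ : ∃ L, L ⊆ insert (v - 1) I ∧ Dominates I L ∧ x ∉ L ∧
      v ∈ L ∧ #{j ∈ L | j ≤ v - 1} = #{j ∈ I | j ≤ v - 1} := by
    by_cases hxI : x ∈ I
    · have hxv' : x ≠ v - 1 := by rintro rfl; exact hvI' hxI
      refine ⟨insert (v - 1) (I.erase x),
        Finset.insert_subset_insert _ (Finset.erase_subset _ _),
        dominates_self.insert_erase h0 h1 h0 hxI hvI' (by omega) (blockStart_mono (by omega)),
        by simp [hxv'], ?_, ?_⟩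
      · simp [hvI]; omega
      · have := card_filter_insert_erase_s14 hxI hvI' (fun j => j ≤ v - 1)
        rwa [if_pos (by omega), if_pos le_rfl, Nat.add_right_cancel_iff] at this
    · exact ⟨I, Finset.subset_insert _ _, dominates_self, hxI, hvI, rfl⟩
  have hL0 : 0 ∉ L := fun h => by
    rcases Finset.mem_insert.1 (hLs h) with h | h
    · omega
    · exact h0 h
  obtain ⟨K, hKs, hK, hxK, hyK, hKc⟩ : ∃ K, K ⊆ insert y L ∧ Dominates I K ∧ x ∉ K ∧
      y ∈ K ∧ #{j ∈ K | j ≤ v - 1} = #{j ∈ I | j ≤ v - 1} := by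
    by_cases hyL : y ∈ L
    · exact ⟨L, Finset.subset_insert _ _, hL, hxL, hyL, hLc⟩
    · refine ⟨insert y (L.erase v), Finset.insert_subset_insert _ (Finset.erase_subset _ _),
        hL.insert_erase h0 h1 hL0 hvL hyL (by omega) (blockStart_mono hvy), ?_, by simp, ?_⟩
      · simp [hxL]; omega
      · have := card_filter_insert_erase_s14 hvL hyL (fun j => j ≤ v - 1)
        rw [if_neg (by omega), if_neg (by omega)] at this
        omega
  refine ⟨K, hKs.trans (Finset.insert_subset_insert _ hLs), hK, hyK, hxK, fun h => ?_⟩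
  have h2 := h.2 (v - 1)
  have h3 := card_filter_insert_erase_s14 hyK hxK (fun j => j ≤ v - 1)
  rw [if_neg (by omega), if_pos (by omega)] at h3
  omega

end BlockStart

lemma map_univ_posEmb {n : ℕ} (π : Equiv.Perm (Fin n)) :
    Finset.univ.map (posEmb π) = Finset.Icc 1 n := by
  refine Finset.eq_of_subset_of_card_le (fun j hj => ?_) (by simp)
  obtain ⟨x, -, rfl⟩ := Finset.mem_map.1 hj
  exact Finset.mem_Icc.2 ⟨Nat.succ_pos _, (π.symm x).isLt⟩

lemma posEmb_mem_Icc {n : ℕ} (π : Equiv.Perm (Fin n)) (x : Fin n) :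
    posEmb π x ∈ Finset.Icc 1 n := by
  rw [← map_univ_posEmb π]
  exact Finset.mem_map_of_mem _ (Finset.mem_univ x)

lemma map_posEmb_subset {n : ℕ} (π : Equiv.Perm (Fin n)) (J : Finset (Fin n)) :
    J.map (posEmb π) ⊆ Finset.Icc 1 n := by
  rw [← map_univ_posEmb π]
  exact Finset.map_subset_map.2 (Finset.subset_univ J)

lemma exists_map_posEmb_eq {n : ℕ} (π : Equiv.Perm (Fin n)) {K : Finset ℕ}
    (hK : K ⊆ Finset.Icc 1 n) : ∃ J : Finset (Fin n), J.map (posEmb π) = K := by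
  rw [← map_univ_posEmb π, Finset.subset_map_iff] at hK
  obtain ⟨J, -, rfl⟩ := hK
  exact ⟨J, rfl⟩

lemma zero_notMem_of_subset_Icc {I : Finset ℕ} {n : ℕ} (hI : I ⊆ Finset.Icc 1 n) : 0 ∉ I :=
  fun h => by simpa using hI h

/-- The part of the ordered set partition of `Fin n` containing an element, named by the
first position of that part. -/
def partLabel {n : ℕ} (I : Finset ℕ) (π : Equiv.Perm (Fin n)) (x : Fin n) : ℕ :=
  blockStart I (posEmb π x)

lemma card_filter_blockStart_map {n : ℕ} (I : Finset ℕ) (π : Equiv.Perm (Fin n))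
    (J : Finset (Fin n)) (v : ℕ) :
    #{j ∈ J.map (posEmb π) | blockStart I j ≤ v} = #{x ∈ J | partLabel I π x ≤ v} := by
  rw [Finset.filter_map, Finset.card_map]
  rfl

section Family

variable {n : ℕ} {I I' : Finset ℕ} {π π' : Equiv.Perm (Fin n)}

lemma mem_positionBases_iff_partLabel (hI : I ⊆ Finset.Icc 1 n) (h1 : 1 ∈ I)
    {J : Finset (Fin n)} :
    J ∈ positionBases I π ↔ #J = #I ∧
      ∀ v, #{x ∈ J | partLabel I π x ≤ v} ≤ #{j ∈ I | blockStart I j ≤ v} := by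
  rw [mem_positionBases, dominates_iff_blockStart (zero_notMem_of_subset_Icc hI) h1
    (zero_notMem_of_subset_Icc (map_posEmb_subset π J)), Finset.card_map]
  simp only [card_filter_blockStart_map]

lemma insert_erase_mem_positionBases (hI : I ⊆ Finset.Icc 1 n) (h1 : 1 ∈ I)
    {J : Finset (Fin n)} (hJ : J ∈ positionBases I π) {x y : Fin n} (hy : y ∈ J) (hx : x ∉ J)
    (hyx : partLabel I π y ≤ partLabel I π x) :
    insert x (J.erase y) ∈ positionBases I π := by
  rw [mem_positionBases] at hJ ⊢
  rw [Finset.map_insert, Finset.map_erase]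
  have := (Finset.mem_Icc.1 (posEmb_mem_Icc π x)).1
  exact hJ.insert_erase (zero_notMem_of_subset_Icc hI) h1
    (zero_notMem_of_subset_Icc (map_posEmb_subset π J)) (Finset.mem_map_of_mem _ hy)
    (by simpa using hx) (by omega) hyx

lemma partLabel_lt_iff (hI : I ⊆ Finset.Icc 1 n) (h1 : 1 ∈ I) (x y : Fin n) :
    partLabel I π x < partLabel I π y ↔
      ∃ J ∈ positionBases I π, y ∈ J ∧ x ∉ J ∧ insert x (J.erase y) ∉ positionBases I π := by
  have h0 := zero_notMem_of_subset_Icc hI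
  constructor
  · intro h
    have hx := Finset.mem_Icc.1 (posEmb_mem_Icc π x)
    have hy := Finset.mem_Icc.1 (posEmb_mem_Icc π y)
    obtain ⟨K, hKs, hK, hyK, hxK, hn⟩ :=
      exists_dominates_not_insert_erase h0 h1 (by omega : posEmb π x ≠ 0) h
    have hs : K ⊆ Finset.Icc 1 n := by
      refine hKs.trans (Finset.insert_subset (posEmb_mem_Icc π y)
        (Finset.insert_subset ?_ hI))
      have h2 := one_le_blockStart h0 h1 hx.1
      have h3 := blockStart_le (I := I) (j := posEmb π y)
      simp only [partLabel] at h
      rw [Finset.mem_Icc]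
      omega
    obtain ⟨J, rfl⟩ := exists_map_posEmb_eq π hs
    refine ⟨J, mem_positionBases.2 hK, by simpa using hyK, by simpa using hxK, ?_⟩
    rwa [mem_positionBases, Finset.map_insert, Finset.map_erase]
  · rintro ⟨J, hJ, hy, hx, hn⟩
    by_contra hle
    exact hn (insert_erase_mem_positionBases hI h1 hJ hy hx (not_lt.1 hle))

lemma partLabel_mem (hI : I ⊆ Finset.Icc 1 n) (h1 : 1 ∈ I) (x : Fin n) :
    partLabel I π x ∈ blockStarts I :=
  blockStart_mem (zero_notMem_of_subset_Icc hI) h1 (Finset.mem_Icc.1 (posEmb_mem_Icc π x)).1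

lemma card_partLabel_lt (hI : I ⊆ Finset.Icc 1 n) (h1 : 1 ∈ I) (x : Fin n) :
    partLabel I π x = #{y | partLabel I π y < partLabel I π x} + 1 := by
  have hm := partLabel_mem (π := π) hI h1 x
  have hx := Finset.mem_Icc.1 (posEmb_mem_Icc π x)
  have h2 := one_le_blockStart (zero_notMem_of_subset_Icc hI) h1 hx.1
  have h3 := blockStart_le (I := I) (j := posEmb π x)
  have : #{y | partLabel I π y < partLabel I π x} = #(Finset.Ico 1 (partLabel I π x)) := by
    rw [← Finset.card_map (posEmb π)]
    congr 1
    ext j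
    simp only [Finset.mem_map, Finset.mem_filter, Finset.mem_univ, true_and, Finset.mem_Ico]
    constructor
    · rintro ⟨y, hy, rfl⟩
      exact ⟨(Finset.mem_Icc.1 (posEmb_mem_Icc π y)).1, (blockStart_lt_iff hm).1 hy⟩
    · rintro ⟨hj, hjx⟩
      have hjn : j ∈ Finset.univ.map (posEmb π) := by
        rw [map_univ_posEmb, Finset.mem_Icc]
        simp only [partLabel] at hjx
        omega
      obtain ⟨y, -, rfl⟩ := Finset.mem_map.1 hjn
      exact ⟨y, (blockStart_lt_iff hm).2 hjx, rfl⟩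
  rw [this, Nat.card_Ico]
  simp only [partLabel] at *
  omega

lemma partLabel_eq_of_positionBases_eq (hI : I ⊆ Finset.Icc 1 n) (h1 : 1 ∈ I)
    (hI' : I' ⊆ Finset.Icc 1 n) (h1' : 1 ∈ I')
    (h : positionBases I π = positionBases I' π') : partLabel I π = partLabel I' π' := by
  ext x
  rw [card_partLabel_lt hI h1, card_partLabel_lt hI' h1']
  simp only [partLabel_lt_iff hI h1, partLabel_lt_iff hI' h1', h]

lemma image_partLabel (hI : I ⊆ Finset.Icc 1 n) (h1 : 1 ∈ I) :
    Finset.univ.image (partLabel I π) = blockStarts I := by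
  ext v
  simp only [Finset.mem_image, Finset.mem_univ, true_and]
  constructor
  · rintro ⟨x, rfl⟩
    exact partLabel_mem hI h1 x
  · intro hv
    have hvn := hI (Finset.mem_filter.1 hv).1
    rw [← map_univ_posEmb π] at hvn
    obtain ⟨x, -, rfl⟩ := Finset.mem_map.1 hvn
    exact ⟨x, blockStart_eq_self hv⟩

lemma positionBases_eq_of_partLabel_eq (hI : I ⊆ Finset.Icc 1 n) (h1 : 1 ∈ I)
    (h : partLabel I π = partLabel I π') : positionBases I π = positionBases I π' := by
  ext J
  rw [mem_positionBases_iff_partLabel hI h1, mem_positionBases_iff_partLabel hI h1, h]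

lemma mem_of_blockStart_counts (hs : blockStart I = blockStart I')
    (hc : ∀ v, #{j ∈ I | blockStart I j ≤ v} ≤ #{j ∈ I' | blockStart I' j ≤ v})
    {p : ℕ} (hlt : ∀ j < p, j ∈ I' → j ∈ I) (hp : p ∈ I) : p ∈ I' := by
  by_contra hp'
  refine absurd (hc (blockStart I p)) (not_le.2 (Finset.card_lt_card ?_))
  rw [Finset.ssubset_iff_of_subset]
  · exact ⟨p, by simp [hp], by simp [hp']⟩
  · intro j hj
    rw [Finset.mem_filter, hs] at hj
    rw [Finset.mem_filter, hs]
    refine ⟨hlt j ?_ hj.1, hj.2⟩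
    by_contra hle
    exact notMem_of_blockStart_eq hp' (not_lt.1 hle) hj.2 hj.1

lemma card_blockStart_le_of_positionBases_eq (hI : I ⊆ Finset.Icc 1 n) (h1 : 1 ∈ I)
    (hI' : I' ⊆ Finset.Icc 1 n) (h1' : 1 ∈ I')
    (h : positionBases I π = positionBases I' π') (v : ℕ) :
    #{j ∈ I | blockStart I j ≤ v} ≤ #{j ∈ I' | blockStart I' j ≤ v} := by
  obtain ⟨J, hJ⟩ := exists_map_posEmb_eq π hI
  have hmem : J ∈ positionBases I' π' := by
    rw [← h, mem_positionBases, hJ]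
    exact dominates_self
  have := ((mem_positionBases_iff_partLabel hI' h1').1 hmem).2 v
  rwa [← partLabel_eq_of_positionBases_eq hI h1 hI' h1' h, ← card_filter_blockStart_map,
    hJ] at this

lemma eq_of_positionBases_eq (hI : I ⊆ Finset.Icc 1 n) (h1 : 1 ∈ I)
    (hI' : I' ⊆ Finset.Icc 1 n) (h1' : 1 ∈ I')
    (h : positionBases I π = positionBases I' π') : I = I' := by
  have hl := partLabel_eq_of_positionBases_eq hI h1 hI' h1' h
  have hs : blockStart I = blockStart I' := by
    ext j
    rw [blockStart, blockStart, ← image_partLabel (π := π) hI h1,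
      ← image_partLabel (π := π') hI' h1', hl]
  ext p
  induction p using Nat.strong_induction_on with
  | _ p ih =>
    exact ⟨mem_of_blockStart_counts hs
        (card_blockStart_le_of_positionBases_eq hI h1 hI' h1' h) fun j hj => (ih j hj).2,
      mem_of_blockStart_counts hs.symm
        (card_blockStart_le_of_positionBases_eq hI' h1' hI h1 h.symm) fun j hj => (ih j hj).1⟩

lemma blockStart_eq_iff {j v : ℕ} (h0 : 0 ∉ I) (h1 : 1 ∈ I) (hj : 1 ≤ j)
    (hv : v ∈ blockStarts I) :
    blockStart I j = v ↔ v ≤ j ∧ ∀ w ∈ blockStarts I, w ≤ j → w ≤ v := by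
  constructor
  · rintro rfl
    exact ⟨blockStart_le, fun w hw => le_blockStart hw⟩
  · rintro ⟨hvj, h⟩
    exact le_antisymm (h _ (blockStart_mem h0 h1 hj) blockStart_le) (le_blockStart hv hvj)

lemma card_blockStart_eq (h0 : 0 ∉ I) (h1 : 1 ∈ I) {N a b : ℕ} (ha : 1 ≤ a)
    (hm : a ∈ blockStarts I) (hbN : b ≤ N) (hb : ∀ w ∈ blockStarts I, a < w → b ≤ w)
    (hb' : b = N ∨ b ∈ blockStarts I ∧ a < b) :
    #{j ∈ Finset.Ico 1 N | blockStart I j = a} = b - a := by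
  rw [← Nat.card_Ico]
  congr 1
  ext j
  rw [Finset.mem_filter, Finset.mem_Ico, Finset.mem_Ico]
  constructor
  · rintro ⟨⟨hj1, hjN⟩, hj⟩
    rw [blockStart_eq_iff h0 h1 hj1 hm] at hj
    refine ⟨hj.1, ?_⟩
    rcases hb' with rfl | ⟨hbm, hab⟩
    · exact hjN
    · by_contra hle
      have := hj.2 b hbm (not_lt.1 hle)
      omega
  · rintro ⟨haj, hjb⟩
    refine ⟨⟨by omega, by omega⟩, ?_⟩
    rw [blockStart_eq_iff h0 h1 (by omega) hm]
    refine ⟨haj, fun w hw hwj => ?_⟩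
    by_contra hlt
    have := hb w hw (not_le.1 hlt)
    omega

lemma prod_diffList_factorial (h0 : 0 ∉ I) (h1 : 1 ∈ I) (N : ℕ) (l : List ℕ) (a : ℕ)
    (ha : 1 ≤ a) (hl : (a :: l).Pairwise (· < ·)) (hmem : ∀ v ∈ a :: l, v ∈ blockStarts I)
    (hall : ∀ v ∈ blockStarts I, a < v → v ∈ l) (hN : ∀ v ∈ a :: l, v < N) :
    ((diffList N a l).map Nat.factorial).prod =
      ((a :: l).map fun v => (#{j ∈ Finset.Ico 1 N | blockStart I j = v}).factorial).prod := by
  induction l generalizing a with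
  | nil =>
    simp only [diffList, List.map_cons, List.map_nil, List.prod_cons, List.prod_nil]
    rw [card_blockStart_eq h0 h1 ha (hmem a (by simp)) le_rfl
      (fun w hw haw => by simpa using hall w hw haw) (Or.inl rfl)]
  | cons b l ih =>
    have hab : a < b := (List.pairwise_cons.1 hl).1 b (by simp)
    have hl' := (List.pairwise_cons.1 hl).2
    have hbm := hmem b (by simp)
    have hbl : ∀ w ∈ blockStarts I, a < w → b ≤ w := fun w hw haw => by
      rcases List.mem_cons.1 (hall w hw haw) with rfl | h
      · exact le_rfl
      · exact ((List.pairwise_cons.1 hl').1 w h).le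
    have hrec := ih b (by omega) hl' (fun v hv => hmem v (List.mem_cons_of_mem _ hv))
      (fun v hv hbv => by
        rcases List.mem_cons.1 (hall v hv (hab.trans hbv)) with rfl | h
        · exact absurd hbv (lt_irrefl _)
        · exact h)
      (fun v hv => hN v (List.mem_cons_of_mem _ hv))
    rw [diffList, List.map_cons, List.prod_cons, hrec, List.map_cons (a := a), List.prod_cons,
      card_blockStart_eq h0 h1 ha (hmem a (by simp)) (hN b (by simp)).le hbl
        (Or.inr ⟨hbm, hab⟩)]

lemma prod_diffList_eq (hI : I ⊆ Finset.Icc 1 n) (h1 : 1 ∈ I) :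
    ((diffList (n + 1) 1 (blockMinima I)).map Nat.factorial).prod =
      ∏ v ∈ blockStarts I, (#{x | partLabel I π x = v}).factorial := by
  have h0 := zero_notMem_of_subset_Icc hI
  have hcard : ∀ v, #{x | partLabel I π x = v} =
      #{j ∈ Finset.Ico 1 (n + 1) | blockStart I j = v} := fun v => by
    have : Finset.Ico 1 (n + 1) = Finset.univ.map (posEmb π) := by
      rw [map_univ_posEmb]; rfl
    rw [this, Finset.filter_map, Finset.card_map]
    rfl
  have hmem : ∀ v, v ∈ blockMinima I ↔ v ∈ blockStarts I := fun v => Finset.mem_sort _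
  have hsort : (blockMinima I).Pairwise (· < ·) := (Finset.sortedLT_sort _).pairwise
  have hval : (blockStarts I).val = blockMinima I := (Finset.sort_eq _ _).symm
  simp only [hcard]
  rw [Finset.prod_eq_multiset_prod, hval, Multiset.map_coe, Multiset.prod_coe]
  have hpos : ∀ v ∈ blockStarts I, 1 ≤ v ∧ v < n + 1 := fun v hv => by
    have := Finset.mem_Icc.1 (hI (Finset.mem_filter.1 hv).1)
    omega
  have hone := (hmem 1).2 (one_mem_blockStarts h0 h1)
  rcases hl : blockMinima I with _ | ⟨a, l⟩
  · simp [hl] at hone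
  rw [hl] at hone hsort hmem
  have ha := hpos a ((hmem a).1 (by simp))
  obtain rfl : a = 1 := by
    rcases List.mem_cons.1 hone with h | h
    · exact h.symm
    · have := (List.pairwise_cons.1 hsort).1 1 h
      omega
  rw [← prod_diffList_factorial h0 h1 (n + 1) l 1 le_rfl hsort (fun v hv => (hmem v).1 hv)
    (fun v hv hlt => ?_) (fun v hv => (hpos v ((hmem v).1 hv)).2)]
  · simp [diffList]
  · rcases List.mem_cons.1 ((hmem v).2 hv) with h | h
    · omega
    · exact h

lemma card_image_positionBases (hI : I ⊆ Finset.Icc 1 n) (h1 : 1 ∈ I) :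
    #(Finset.univ.image (positionBases (n := n) I)) = binomDelta n I := by
  have hfib : ∀ B ∈ Finset.univ.image (positionBases (n := n) I),
      #{π | positionBases (n := n) I π = B} =
        ((diffList (n + 1) 1 (blockMinima I)).map Nat.factorial).prod := by
    intro B hB
    obtain ⟨π, -, rfl⟩ := Finset.mem_image.1 hB
    rw [prod_diffList_eq (π := π) hI h1, ← image_partLabel (π := π) hI h1]
    have := DomMulAct.stabilizer_card' (f := partLabel I π)
    simp only [Fintype.card_subtype] at this
    rw [← this]
    refine Finset.card_equiv ((Equiv.inv _).trans (Equiv.mulLeft π)) fun τ => ?_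
    have hτ : partLabel I π ∘ (π * τ⁻¹ : Equiv.Perm (Fin n)) = partLabel I τ := by
      ext x
      have hx : posEmb π (π (τ.symm x)) = posEmb τ x := by
        change (π.symm (π (τ.symm x))).val + 1 = (τ.symm x).val + 1
        rw [Equiv.symm_apply_apply]
      exact congrArg (blockStart I) hx
    simp only [Finset.mem_filter, Finset.mem_univ, true_and, Equiv.trans_apply, Equiv.inv_apply,
      Equiv.coe_mulLeft, hτ]
    exact ⟨partLabel_eq_of_positionBases_eq hI h1 hI h1, positionBases_eq_of_partLabel_eq hI h1⟩
  have := Finset.card_eq_sum_card_image (positionBases (n := n) I) Finset.univ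
  rw [Finset.sum_congr rfl hfib, Finset.sum_const, smul_eq_mul, Finset.card_univ,
    Fintype.card_perm, Fintype.card_fin] at this
  rw [binomDelta, this, Nat.mul_div_cancel]
  refine Nat.pos_of_ne_zero fun h => ?_
  rw [h, Nat.mul_zero] at this
  exact Nat.factorial_ne_zero n this

end Family

/-- Every finite set contains a top segment of any smaller size with respect to an injective
labelling. -/
lemma exists_subset_card_eq_top {α : Type*} [DecidableEq α] (g : α ↪ ℕ) (S : Finset α) (r : ℕ)
    (hr : r ≤ #S) :
    ∃ J ⊆ S, #J = r ∧ ∀ a ∈ S, a ∉ J → ∀ b ∈ J, g a < g b := by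
  induction r with
  | zero => exact ⟨∅, by simp⟩
  | succ r ih =>
    obtain ⟨J, hJS, hJ, htop⟩ := ih (by omega)
    have hne : (S \ J).Nonempty := by
      rw [← Finset.card_pos, Finset.card_sdiff_of_subset hJS]
      omega
    obtain ⟨c, hc, hmax⟩ := Finset.exists_max_image (S \ J) g hne
    rw [Finset.mem_sdiff] at hc
    refine ⟨insert c J, Finset.insert_subset hc.1 hJS, by simp [hc.2, hJ], ?_⟩
    intro a ha haJ b hb
    rw [Finset.mem_insert, not_or] at haJ
    rcases Finset.mem_insert.1 hb with rfl | hb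
    · exact lt_of_le_of_ne (hmax a (Finset.mem_sdiff.2 ⟨ha, haJ.2⟩))
        fun h => haJ.1 (g.injective h)
    · exact htop a ha haJ.2 b hb

section Characterization

variable {n : ℕ} {I : Finset ℕ} {π : Equiv.Perm (Fin n)}

lemma positionBases_loopless_iff (hn : 1 ≤ n) (hI : I ⊆ Finset.Icc 1 n) :
    (∀ x : Fin n, ∃ J ∈ positionBases I π, x ∈ J) ↔ 1 ∈ I := by
  have hex : ∃ x, posEmb π x = 1 := by
    have : 1 ∈ Finset.univ.map (posEmb π) := by
      rw [map_univ_posEmb]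
      simpa using hn
    simpa using this
  obtain ⟨x₀, hx₀⟩ := hex
  constructor
  · intro h
    obtain ⟨J, hJ, hx⟩ := h x₀
    have hle := (mem_positionBases.1 hJ).2 1
    have hpos : 0 < #{j ∈ J.map (posEmb π) | j ≤ 1} :=
      Finset.card_pos.2 ⟨1, Finset.mem_filter.2
        ⟨hx₀ ▸ Finset.mem_map_of_mem _ hx, le_rfl⟩⟩
    obtain ⟨i, hi⟩ := Finset.card_pos.1 (hpos.trans_le hle)
    rw [Finset.mem_filter] at hi
    have := Finset.mem_Icc.1 (hI hi.1)
    obtain rfl : i = 1 := by omega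
    exact hi.1
  · intro h1 x
    obtain ⟨J, hJ⟩ := exists_map_posEmb_eq π hI
    have hJm : J ∈ positionBases I π := by
      rw [mem_positionBases, hJ]
      exact dominates_self
    by_cases hx : x ∈ J
    · exact ⟨J, hJm, hx⟩
    · have hx₀J : x₀ ∈ J := by
        rw [← hJ, ← hx₀] at h1
        simpa using h1
      refine ⟨_, insert_erase_mem_positionBases hI h1 hJm hx₀J hx (blockStart_mono ?_),
        Finset.mem_insert_self _ _⟩
      rw [hx₀]
      exact (Finset.mem_Icc.1 (posEmb_mem_Icc π x)).1

lemma positionBases_cogirth_iff {k : ℕ} (hkn : k ≤ n) (hI : I ⊆ Finset.Icc 1 n) (hIk : #I ≤ k) :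
    (∀ S : Finset (Fin n), k ≤ #S → ∃ J ∈ positionBases I π, J ⊆ S) ↔
      I ⊆ Finset.Icc 1 k := by
  constructor
  · intro h
    obtain ⟨S, hS⟩ := exists_map_posEmb_eq π (Finset.Icc_subset_Icc_right (a := 1) hkn)
    have hSk : #S = k := by rw [← Finset.card_map (posEmb π), hS, Nat.card_Icc]; omega
    obtain ⟨J, hJ, hJS⟩ := h S hSk.ge
    rw [mem_positionBases] at hJ
    have hle := hJ.2 k
    rw [Finset.filter_true_of_mem, hJ.1] at hle
    · have heq := Finset.eq_of_subset_of_card_le (Finset.filter_subset _ I) hle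
      intro i hi
      rw [← heq, Finset.mem_filter] at hi
      exact Finset.mem_Icc.2 ⟨(Finset.mem_Icc.1 (hI hi.1)).1, hi.2⟩
    · intro j hj
      have := Finset.map_subset_map.2 hJS hj
      rw [hS] at this
      exact (Finset.mem_Icc.1 this).2
  · intro h S hS
    obtain ⟨J, hJS, hJ, htop⟩ := exists_subset_card_eq_top (posEmb π) S (#I) (hIk.trans hS)
    refine ⟨J, mem_positionBases.2 ⟨by simpa using hJ, fun p => ?_⟩, hJS⟩
    have split : ∀ L : Finset ℕ, #{j ∈ L | j ≤ p} + #{j ∈ L | ¬ j ≤ p} = #L :=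
      fun L => Finset.card_filter_add_card_filter_not _
    by_cases hlow : ∀ a ∈ S, a ∉ J → posEmb π a ≤ p
    · have hJp : #{j ∈ S.map (posEmb π) | ¬ j ≤ p} ≤ #{j ∈ J.map (posEmb π) | ¬ j ≤ p} := by
        refine Finset.card_le_card fun j hj => ?_
        rw [Finset.mem_filter, Finset.mem_map] at hj
        obtain ⟨⟨a, ha, rfl⟩, hap⟩ := hj
        refine Finset.mem_filter.2 ⟨Finset.mem_map_of_mem _ ?_, hap⟩
        by_contra haJ
        exact hap (hlow a ha haJ)
      have hSp : #{j ∈ S.map (posEmb π) | j ≤ p} ≤ p := by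
        refine (Finset.card_le_card (t := Finset.Icc 1 p) fun j hj => ?_).trans (by simp)
        rw [Finset.mem_filter] at hj
        exact Finset.mem_Icc.2 ⟨(Finset.mem_Icc.1 (map_posEmb_subset π S hj.1)).1, hj.2⟩
      have hIp : #{j ∈ I | ¬ j ≤ p} ≤ k - p := by
        refine (Finset.card_le_card (t := Finset.Ioc p k) fun j hj => ?_).trans (by simp)
        rw [Finset.mem_filter] at hj
        exact Finset.mem_Ioc.2 ⟨not_le.1 hj.2, (Finset.mem_Icc.1 (h hj.1)).2⟩
      have s1 := split (S.map (posEmb π))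
      have s2 := split (J.map (posEmb π))
      have s3 := split I
      rw [Finset.card_map] at s1 s2
      omega
    · push Not at hlow
      obtain ⟨a, ha, haJ, hap⟩ := hlow
      rw [Finset.filter_eq_empty_iff.2]
      · simp
      · intro j hj
        obtain ⟨b, hb, rfl⟩ := Finset.mem_map.1 hj
        exact not_le.2 (hap.trans (htop a ha haJ b hb))

end Characterization

/-- For `1 ≤ k ≤ n` and `0 ≤ m ≤ k - 1`, the number of distinct loopless
Schubert matroids on `[n]` of rank `m + 1` and cogirth greater than `n - k` (distinct base
families `B_{I,π}` such that every element lies in some member, and every subset of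
cardinality at least `k` contains a member) equals
`Σ_{I ⊆ {1,…,k}, 1 ∈ I, |I| = m+1} binom(n, ΔI)`, the coefficient of `x^m` in the Chow
polynomial of the uniform matroid `U_{k,n}`. -/
theorem card_loopless_schubert_rank_cogirth (n k m : ℕ) (hk : 1 ≤ k) (hkn : k ≤ n)
    (hm : m ≤ k - 1) :
    {B : Finset (Finset (Fin n)) |
        (∃ (I : Finset (Fin n)) (π : Equiv.Perm (Fin n)),
            I.card = m + 1 ∧ B = schubertBases π I)
        ∧ (∀ x : Fin n, ∃ J ∈ B, x ∈ J)
        ∧ (∀ S : Finset (Fin n), k ≤ S.card → ∃ J ∈ B, J ⊆ S)}.ncard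
      = ∑ I ∈ (Finset.Icc 1 k).powerset.filter (fun I => 1 ∈ I ∧ I.card = m + 1),
          binomDelta n I := by
  set T := (Finset.Icc 1 k).powerset.filter (fun I => 1 ∈ I ∧ #I = m + 1) with hT
  have hmem : ∀ I ∈ T, I ⊆ Finset.Icc 1 k ∧ I ⊆ Finset.Icc 1 n ∧ 1 ∈ I ∧ #I = m + 1 := by
    intro I hI
    rw [hT, Finset.mem_filter, Finset.mem_powerset] at hI
    exact ⟨hI.1, hI.1.trans (Finset.Icc_subset_Icc_right hkn), hI.2⟩
  have hset : {B : Finset (Finset (Fin n)) |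
        (∃ (I : Finset (Fin n)) (π : Equiv.Perm (Fin n)),
            I.card = m + 1 ∧ B = schubertBases π I)
        ∧ (∀ x : Fin n, ∃ J ∈ B, x ∈ J)
        ∧ (∀ S : Finset (Fin n), k ≤ S.card → ∃ J ∈ B, J ⊆ S)} =
      ↑(T.biUnion fun I => Finset.univ.image (positionBases (n := n) I)) := by
    ext B
    simp only [Set.mem_ofPred_eq, Finset.mem_coe, Finset.mem_biUnion, Finset.mem_image,
      Finset.mem_univ, true_and]
    constructor
    · rintro ⟨⟨I, π, hI, rfl⟩, hloop, hcog⟩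
      rw [schubertBases_eq_positionBases] at *
      have hs := map_posEmb_subset π I
      have hc : #(I.map (posEmb π)) = m + 1 := by rw [Finset.card_map, hI]
      rw [positionBases_loopless_iff (hk.trans hkn) hs] at hloop
      rw [positionBases_cogirth_iff hkn hs (by omega)] at hcog
      exact ⟨_, Finset.mem_filter.2 ⟨Finset.mem_powerset.2 hcog, hloop, hc⟩, π, rfl⟩
    · rintro ⟨I, hIT, π, rfl⟩
      obtain ⟨hIk, hIn, h1, hc⟩ := hmem I hIT
      refine ⟨?_, (positionBases_loopless_iff (hk.trans hkn) hIn).2 h1,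
        (positionBases_cogirth_iff hkn hIn (by omega)).2 hIk⟩
      obtain ⟨J, rfl⟩ := exists_map_posEmb_eq π hIn
      exact ⟨J, π, by simpa using hc, (schubertBases_eq_positionBases π J).symm⟩
  rw [hset, Set.ncard_coe_finset, Finset.card_biUnion]
  · exact Finset.sum_congr rfl fun I hI =>
      card_image_positionBases (hmem I hI).2.1 (hmem I hI).2.2.1
  · intro I hI I' hI' hne
    refine Finset.disjoint_left.2 fun B hB hB' => ?_
    obtain ⟨π, -, rfl⟩ := Finset.mem_image.1 hB
    obtain ⟨π', -, h⟩ := Finset.mem_image.1 hB'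
    exact hne (eq_of_positionBases_eq (hmem I hI).2.1 (hmem I hI).2.2.1
      (hmem I' hI').2.1 (hmem I' hI').2.2.1 h.symm)
end

section
/- Let 1 ≤ k ≤ n and 0 ≤ m ≤ k. The number of distinct Schubert matroids on ground set [n] of rank m and cogirth greater than n − k (i.e. distinct base families B_{I,π} over all I ⊆ [n] with |I| = m and π ∈ S_n — where for I = ∅ the family is B_{∅,π} = {∅} — such that every subset of [n] of cardinality at least k contains a member of the family; for m = 0 this cogirth condition holds vacuously since ∅ is contained in every subset) equals Σ_{I ⊆ {1,…,k}, |I| = m} binom(n, ΔI), which is the coefficient of x^m in the augmented Chow polynomial of the uniform matroid U_{k,n}. -/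
open Finset

/-- The position of `a` in the order `≤_π`, counted from one. -/
def piPos {n : ℕ} (π : Equiv.Perm (Fin n)) (a : Fin n) : ℕ :=
  (π.symm a : ℕ) + 1

lemma piPos_injective {n : ℕ} (π : Equiv.Perm (Fin n)) : Function.Injective (piPos π) := by
  intro a b h
  simp only [piPos, Nat.add_right_cancel_iff] at h
  exact π.symm.injective (Fin.ext h)

lemma piPos_pos {n : ℕ} (π : Equiv.Perm (Fin n)) (a : Fin n) : 1 ≤ piPos π a := by
  simp [piPos]

lemma piPos_le {n : ℕ} (π : Equiv.Perm (Fin n)) (a : Fin n) : piPos π a ≤ n := by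
  have := (π.symm a).isLt
  simp only [piPos]; omega

lemma exists_piPos_eq {n : ℕ} (π : Equiv.Perm (Fin n)) {p : ℕ} (h₁ : 1 ≤ p) (h₂ : p ≤ n) :
    ∃ a, piPos π a = p :=
  ⟨π ⟨p - 1, by omega⟩, by simp only [piPos, Equiv.symm_apply_apply]; omega⟩

/-- The first `p` elements of the order `≤_π`. -/
def piPrefix {n : ℕ} (π : Equiv.Perm (Fin n)) (p : ℕ) : Finset (Fin n) :=
  univ.filter fun a => piPos π a ≤ p

@[simp]
lemma mem_piPrefix {n : ℕ} {π : Equiv.Perm (Fin n)} {p : ℕ} {a : Fin n} :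
    a ∈ piPrefix π p ↔ piPos π a ≤ p := by
  simp [piPrefix]

lemma card_piPrefix {n : ℕ} (π : Equiv.Perm (Fin n)) {p : ℕ} (hp : p ≤ n) :
    (piPrefix π p).card = p := by
  have h : (piPrefix π p).image (piPos π) = Icc 1 p := by
    ext q
    simp only [mem_image, mem_piPrefix, mem_Icc]
    constructor
    · rintro ⟨a, ha, rfl⟩
      exact ⟨piPos_pos π a, ha⟩
    · rintro ⟨h₁, h₂⟩
      obtain ⟨a, rfl⟩ := exists_piPos_eq π h₁ (h₂.trans hp)
      exact ⟨a, h₂, rfl⟩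
  rw [← card_image_of_injective _ (piPos_injective π), h]
  simp

open Classical in
/-- The sets with as many elements as `P` having, for every `q`, at most as many elements among
the first `q` positions of `≤_π` as `P` has among `1, …, q`. -/
noncomputable def prefixBases {n : ℕ} (π : Equiv.Perm (Fin n)) (P : Finset ℕ) :
    Finset (Finset (Fin n)) :=
  univ.filter fun J => J.card = P.card ∧ ∀ q, (J ∩ piPrefix π q).card ≤ (P ∩ Icc 1 q).card

lemma piPrefix_of_le {n : ℕ} (π : Equiv.Perm (Fin n)) {q : ℕ} (hq : n ≤ q) :
    piPrefix π q = univ := by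
  ext a
  simpa using (piPos_le π a).trans hq

lemma mem_prefixBases {n : ℕ} {π : Equiv.Perm (Fin n)} {P : Finset ℕ} {J : Finset (Fin n)} :
    J ∈ prefixBases π P ↔ J.card = P.card ∧
      ∀ q, (J ∩ piPrefix π q).card ≤ (P ∩ Icc 1 q).card := by
  simp [prefixBases]

lemma forall₂_le_iff_countP_le {α : Type*} (f : α → ℕ) {l₁ l₂ : List α}
    (h₁ : l₁.Pairwise fun a b => f a ≤ f b) (h₂ : l₂.Pairwise fun a b => f a ≤ f b) :
    List.Forall₂ (fun a b => f a ≤ f b) l₁ l₂ ↔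
      l₁.length = l₂.length ∧
        ∀ q, l₂.countP (fun a => f a ≤ q) ≤ l₁.countP (fun a => f a ≤ q) := by
  induction l₁ generalizing l₂ with
  | nil => cases l₂ <;> simp
  | cons a l₁ ih =>
    cases l₂ with
    | nil => simp
    | cons b l₂ =>
      rw [List.pairwise_cons] at h₁ h₂
      rw [List.forall₂_cons, ih h₁.2 h₂.2]
      simp only [List.length_cons, Nat.add_right_cancel_iff, List.countP_cons, decide_eq_true_eq]
      constructor
      · rintro ⟨hab, hl, h⟩
        refine ⟨hl, fun q => ?_⟩
        have := h q
        split_ifs <;> omega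
      · rintro ⟨hl, h⟩
        have hab : f a ≤ f b := by
          by_contra! hlt
          have h0 : l₁.countP (fun x => f x ≤ f b) = 0 := by
            rw [List.countP_eq_zero]
            intro x hx
            have := h₁.1 x hx
            simp only [decide_eq_true_eq]
            omega
          have := h (f b)
          rw [if_pos le_rfl, if_neg (by omega), h0] at this
          omega
        refine ⟨hab, hl, fun q => ?_⟩
        by_cases hq : f b ≤ q
        · have := h q
          rw [if_pos hq, if_pos (hab.trans hq)] at this
          omega
        · have h0 : l₂.countP (fun x => f x ≤ q) = 0 := by
            rw [List.countP_eq_zero]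
            intro x hx
            have := h₂.1 x hx
            simp only [decide_eq_true_eq]
            omega
          omega

lemma countP_piSort {n : ℕ} (π : Equiv.Perm (Fin n)) (I : Finset (Fin n)) (q : ℕ) :
    (piSort π I).countP (fun a => piPos π a ≤ q) = (I ∩ piPrefix π q).card := by
  have h : I ∩ piPrefix π q = I.filter fun a => piPos π a ≤ q := by
    ext a; simp
  rw [h, card_def, filter_val, ← Multiset.countP_eq_card_filter, ← sort_eq I (piLE π),
    Multiset.coe_countP]
  rfl

lemma piDom_iff {n : ℕ} (π : Equiv.Perm (Fin n)) (I J : Finset (Fin n)) :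
    piDom π I J ↔ I.card = J.card ∧
      ∀ q, (J ∩ piPrefix π q).card ≤ (I ∩ piPrefix π q).card := by
  have hle : piLE π = fun a b => piPos π a ≤ piPos π b := by
    funext a b
    simp [piLE, piPos]
  have hs : ∀ K : Finset (Fin n), (piSort π K).Pairwise fun a b => piPos π a ≤ piPos π b := by
    intro K
    rw [← hle]
    exact pairwise_sort K (piLE π)
  have hlen : ∀ K : Finset (Fin n), (piSort π K).length = K.card := fun K => length_sort _
  have := forall₂_le_iff_countP_le (piPos π) (hs I) (hs J)
  rw [hlen, hlen] at this
  simp only [countP_piSort] at this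
  rw [← this, piDom, hle]

lemma image_piPos_subset {n : ℕ} (π : Equiv.Perm (Fin n)) (I : Finset (Fin n)) :
    I.image (piPos π) ⊆ Icc 1 n := by
  intro q hq
  obtain ⟨a, _, rfl⟩ := mem_image.1 hq
  exact mem_Icc.2 ⟨piPos_pos π a, piPos_le π a⟩

lemma schubertBases_eq_prefixBases {n : ℕ} (π : Equiv.Perm (Fin n)) (I : Finset (Fin n)) :
    schubertBases π I = prefixBases π (I.image (piPos π)) := by
  have hI : ∀ q, (I.image (piPos π) ∩ Icc 1 q).card = (I ∩ piPrefix π q).card := by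
    intro q
    rw [← card_image_of_injective (I ∩ piPrefix π q) (piPos_injective π)]
    congr 1
    ext r
    simp only [mem_inter, mem_image, mem_Icc, mem_piPrefix]
    constructor
    · rintro ⟨⟨a, ha, rfl⟩, _, h⟩
      exact ⟨a, ⟨ha, h⟩, rfl⟩
    · rintro ⟨a, ⟨ha, h⟩, rfl⟩
      exact ⟨⟨a, ha, rfl⟩, piPos_pos π a, h⟩
  ext J
  rw [mem_prefixBases, card_image_of_injective _ (piPos_injective π)]
  simp only [hI, schubertBases, mem_filter, mem_univ, true_and, piDom_iff]
  exact and_congr_right fun h => by simp [h]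

lemma exists_image_piPos_eq {n : ℕ} (π : Equiv.Perm (Fin n)) {P : Finset ℕ} (hP : P ⊆ Icc 1 n) :
    ∃ I : Finset (Fin n), I.image (piPos π) = P := by
  refine ⟨univ.filter fun a => piPos π a ∈ P, ?_⟩
  ext q
  simp only [mem_image, mem_filter, mem_univ, true_and]
  constructor
  · rintro ⟨a, ha, rfl⟩
    exact ha
  · intro hq
    obtain ⟨a, rfl⟩ := exists_piPos_eq π (mem_Icc.1 (hP hq)).1 (mem_Icc.1 (hP hq)).2
    exact ⟨a, hq, rfl⟩

lemma card_inter_Icc_succ (P : Finset ℕ) (q : ℕ) :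
    (P ∩ Icc 1 (q + 1)).card = (P ∩ Icc 1 q).card + if q + 1 ∈ P then 1 else 0 := by
  rw [← insert_Icc_right_eq_Icc_add_one (by omega)]
  split_ifs with h
  · rw [inter_insert_of_mem h, card_insert_of_notMem (by simp)]
  · rw [inter_insert_of_notMem h, add_zero]

lemma piPrefix_succ {n : ℕ} (π : Equiv.Perm (Fin n)) {q : ℕ} {a : Fin n} (ha : piPos π a = q + 1) :
    piPrefix π (q + 1) = insert a (piPrefix π q) := by
  ext b
  simp only [mem_piPrefix, mem_insert]
  constructor
  · intro h
    rcases Nat.lt_or_eq_of_le h with h | h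
    · exact Or.inr (by omega)
    · exact Or.inl (piPos_injective π (h.trans ha.symm))
  · rintro (rfl | h) <;> omega

lemma card_inter_piPrefix_succ_le {n : ℕ} (π : Equiv.Perm (Fin n)) (J : Finset (Fin n)) (q : ℕ) :
    (J ∩ piPrefix π (q + 1)).card ≤ (J ∩ piPrefix π q).card + 1 := by
  by_cases hq : q + 1 ≤ n
  · obtain ⟨a, ha⟩ := exists_piPos_eq π (by omega) hq
    rw [piPrefix_succ π ha]
    refine (card_le_card ?_).trans (card_insert_le a _)
    intro b
    simp only [mem_inter, mem_insert]
    tauto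
  · rw [piPrefix_of_le π (q := q) (by omega), piPrefix_of_le π (by omega)]
    omega

lemma exists_prefixBases_superset {n : ℕ} (π : Equiv.Perm (Fin n)) {P : Finset ℕ}
    (hP : P ⊆ Icc 1 n) (K : Finset (Fin n))
    (hK : ∀ q, (K ∩ piPrefix π q).card ≤ (P ∩ Icc 1 q).card) :
    ∃ J ∈ prefixBases π P, K ⊆ J := by
  have hKP : K.card ≤ P.card := by
    have := hK n
    rwa [piPrefix_of_le π le_rfl, inter_univ, inter_eq_left.2 hP] at this
  obtain ⟨d, hd⟩ := Nat.exists_eq_add_of_le hKP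
  induction d generalizing K with
  | zero => exact ⟨K, mem_prefixBases.2 ⟨hd.symm, hK⟩, subset_rfl⟩
  | succ d ih =>
    let tight : ℕ → Prop := fun q => (K ∩ piPrefix π q).card = (P ∩ Icc 1 q).card
    have h0 : tight 0 := by
      have := hK 0
      simp only [tight]
      simp at this ⊢
      exact this
    have hn : ∀ q, n ≤ q → ¬ tight q := by
      intro q hq h
      simp only [tight] at h
      rw [piPrefix_of_le π hq, inter_univ,
        inter_eq_left.2 (hP.trans (Icc_subset_Icc_right hq))] at h
      omega
    obtain ⟨q, hq, hmax⟩ : ∃ q, tight q ∧ ∀ r, q < r → ¬ tight r := by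
      classical
      refine ⟨Nat.findGreatest tight n, Nat.findGreatest_spec (Nat.zero_le _) h0, fun r hr => ?_⟩
      by_cases hrn : r ≤ n
      · exact Nat.findGreatest_is_greatest hr hrn
      · exact hn r (by omega)
    have hqn : q < n := by
      by_contra! h
      exact hn q h hq
    obtain ⟨a, ha⟩ := exists_piPos_eq π (p := q + 1) (by omega) hqn
    have haK : a ∉ K := by
      intro haK
      have h1 := hK (q + 1)
      have h2 := hmax (q + 1) (by omega)
      simp only [tight] at hq h2
      rw [piPrefix_succ π ha, inter_insert_of_mem haK,
        card_insert_of_notMem (by simp [ha])] at h1 h2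
      rw [card_inter_Icc_succ] at h1 h2
      split_ifs at h1 h2 <;> omega
    obtain ⟨J, hJ, hKJ⟩ := ih (insert a K) (fun r => by
        by_cases har : q + 1 ≤ r
        · rw [insert_inter_of_mem (by simpa [ha] using har), card_insert_of_notMem (by simp [haK])]
          have h1 := hK r
          have h2 := hmax r (by omega)
          simp only [tight] at h2
          omega
        · rw [insert_inter_of_notMem (by simpa [ha] using har)]
          exact hK r)
      (by rw [card_insert_of_notMem haK]; omega) (by rw [card_insert_of_notMem haK]; omega)
    exact ⟨J, hJ, (subset_insert _ _).trans hKJ⟩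

lemma exists_prefixBases_card_inter_ge {n : ℕ} (π : Equiv.Perm (Fin n)) {P : Finset ℕ}
    (hP : P ⊆ Icc 1 n) (S : Finset (Fin n)) (ρ : Fin n → ℕ) (hinj : Set.InjOn ρ S)
    (hρ : ∀ a ∈ S, ρ a ≤ piPos π a) :
    ∃ J ∈ prefixBases π P, (P ∩ S.image ρ).card ≤ (J ∩ S).card := by
  obtain ⟨J, hJ, hKJ⟩ := exists_prefixBases_superset π hP (S.filter fun a => ρ a ∈ P) (by
    intro q
    refine card_le_card_of_injOn ρ ?_ (hinj.mono ?_)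
    · intro a ha
      simp only [coe_inter, coe_filter, Set.mem_inter_iff, Set.mem_ofPred_eq, mem_coe,
        mem_piPrefix] at ha
      simp only [mem_coe, mem_inter, mem_Icc]
      exact ⟨ha.1.2, (mem_Icc.1 (hP ha.1.2)).1, (hρ a ha.1.1).trans ha.2⟩
    · intro a ha
      simp only [coe_inter, coe_filter, Set.mem_inter_iff, Set.mem_ofPred_eq] at ha
      exact ha.1.1)
  refine ⟨J, hJ, ?_⟩
  have hsub : P ∩ S.image ρ ⊆ (J ∩ S).image ρ := by
    intro q hq
    obtain ⟨hqP, hqS⟩ := mem_inter.1 hq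
    obtain ⟨a, ha, rfl⟩ := mem_image.1 hqS
    exact mem_image_of_mem _ (mem_inter.2 ⟨hKJ (mem_filter.2 ⟨ha, hqP⟩), ha⟩)
  exact (card_le_card hsub).trans card_image_le

lemma exists_rank {n : ℕ} (π : Equiv.Perm (Fin n)) (S : Finset (Fin n)) :
    ∃ ρ : Fin n → ℕ, Set.InjOn ρ S ∧ (∀ a ∈ S, ρ a ≤ piPos π a) ∧
      S.image ρ = Icc 1 S.card := by
  have hinj : Set.InjOn (fun a => (S ∩ piPrefix π (piPos π a)).card) S := by
    have key : ∀ a ∈ S, ∀ b ∈ S, piPos π a < piPos π b →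
        (S ∩ piPrefix π (piPos π a)).card < (S ∩ piPrefix π (piPos π b)).card := by
      intro a _ b hb hab
      refine card_lt_card (ssubset_iff_of_subset ?_ |>.2 ⟨b, ?_, ?_⟩)
      · intro c
        simp only [mem_inter, mem_piPrefix]
        exact fun h => ⟨h.1, h.2.trans hab.le⟩
      · simp [hb]
      · simp [hab]
    intro a ha b hb hab
    rcases lt_trichotomy (piPos π a) (piPos π b) with h | h | h
    · exact absurd hab (key a ha b hb h).ne
    · exact piPos_injective π h
    · exact absurd hab (key b hb a ha h).ne'
  refine ⟨_, hinj, fun a _ => ?_, ?_⟩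
  · exact (card_le_card inter_subset_right).trans (card_piPrefix π (piPos_le π a)).le
  · refine eq_of_subset_of_card_le ?_ ?_
    · intro q hq
      obtain ⟨a, ha, rfl⟩ := mem_image.1 hq
      exact mem_Icc.2 ⟨card_pos.2 ⟨a, by simp [ha]⟩, card_le_card inter_subset_left⟩
    · rw [card_image_of_injOn hinj]
      simp

lemma exists_prefixBases_card_inter_ge_card {n : ℕ} (π : Equiv.Perm (Fin n)) {P : Finset ℕ}
    (hP : P ⊆ Icc 1 n) (S : Finset (Fin n)) :
    ∃ J ∈ prefixBases π P, (P ∩ Icc 1 S.card).card ≤ (J ∩ S).card := by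
  obtain ⟨ρ, hinj, hρ, him⟩ := exists_rank π S
  rw [← him]
  exact exists_prefixBases_card_inter_ge π hP S ρ hinj hρ

lemma eq_of_prefixBases_eq {n : ℕ} {π σ : Equiv.Perm (Fin n)} {P Q : Finset ℕ}
    (hP : P ⊆ Icc 1 n) (hQ : Q ⊆ Icc 1 n) (h : prefixBases π P = prefixBases σ Q) : P = Q := by
  have key : ∀ (π σ : Equiv.Perm (Fin n)) (P Q : Finset ℕ), P ⊆ Icc 1 n → Q ⊆ Icc 1 n →
      prefixBases π P = prefixBases σ Q →
      ∀ q ≤ n, (P ∩ Icc 1 q).card ≤ (Q ∩ Icc 1 q).card := by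
    intro π σ P Q hP hQ h q hq
    obtain ⟨J, hJ, hle⟩ := exists_prefixBases_card_inter_ge_card π hP (piPrefix σ q)
    rw [card_piPrefix σ hq] at hle
    rw [h] at hJ
    exact hle.trans ((mem_prefixBases.1 hJ).2 q)
  have hcard : ∀ q ≤ n, (P ∩ Icc 1 q).card = (Q ∩ Icc 1 q).card := fun q hq =>
    le_antisymm (key π σ P Q hP hQ h q hq) (key σ π Q P hQ hP h.symm q hq)
  ext q
  by_cases hq : q ∈ Icc 1 n
  · obtain ⟨h1, h2⟩ := mem_Icc.1 hq
    obtain ⟨r, rfl⟩ := Nat.exists_eq_add_of_le' h1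
    have e1 := hcard (r + 1) h2
    have e2 := hcard r (by omega)
    rw [card_inter_Icc_succ, card_inter_Icc_succ] at e1
    split_ifs at e1 <;> first | omega | tauto
  · exact iff_of_false (fun h => hq (hP h)) (fun h => hq (hQ h))

lemma exists_prefixBases_card_inter_gt {n : ℕ} (π : Equiv.Perm (Fin n)) {P : Finset ℕ}
    (hP : P ⊆ Icc 1 n) (S : Finset (Fin n)) (h₁ : S.card ∉ P) (h₂ : S.card + 1 ∈ P)
    (hS : S ≠ piPrefix π S.card) :
    ∃ J ∈ prefixBases π P, (P ∩ Icc 1 S.card).card < (J ∩ S).card := by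
  have hn : S.card + 1 ≤ n := (mem_Icc.1 (hP h₂)).2
  obtain ⟨b, hb, hbS⟩ : ∃ b ∈ S, S.card < piPos π b := by
    by_contra! h
    refine hS (eq_of_subset_of_card_le (fun a ha => mem_piPrefix.2 (h a ha)) ?_)
    rw [card_piPrefix π (by omega)]
  obtain ⟨ρ, hinj, hρ, him⟩ := exists_rank π (S.erase b)
  have hlt : ∀ a ∈ S, a ≠ b → 1 ≤ ρ a ∧ ρ a ≤ S.card - 1 := by
    intro a ha hab
    have : ρ a ∈ (S.erase b).image ρ := mem_image_of_mem _ (mem_erase.2 ⟨hab, ha⟩)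
    rwa [him, mem_Icc, card_erase_of_mem hb] at this
  obtain ⟨J, hJ, hle⟩ := exists_prefixBases_card_inter_ge π hP S
    (Function.update ρ b (S.card + 1)) (by
      intro x hx y hy hxy
      by_cases hxb : x = b <;> by_cases hyb : y = b
      · rw [hxb, hyb]
      · subst hxb
        rw [Function.update_self, Function.update_of_ne hyb] at hxy
        have := hlt y hy hyb
        omega
      · subst hyb
        rw [Function.update_self, Function.update_of_ne hxb] at hxy
        have := hlt x hx hxb
        omega
      · rw [Function.update_of_ne hxb, Function.update_of_ne hyb] at hxy
        exact hinj (by simp [hxb, mem_coe.1 hx]) (by simp [hyb, mem_coe.1 hy]) hxy) (by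
      intro a ha
      by_cases hab : a = b
      · subst hab
        rw [Function.update_self]
        omega
      · rw [Function.update_of_ne hab]
        exact hρ a (mem_erase.2 ⟨hab, ha⟩))
  refine ⟨J, hJ, lt_of_lt_of_le ?_ hle⟩
  refine card_lt_card (ssubset_iff_of_subset ?_ |>.2 ⟨S.card + 1, ?_, by simp⟩)
  · intro q hq
    obtain ⟨hqP, hq⟩ := mem_inter.1 hq
    have hne : q ≠ S.card := fun h => h₁ (h ▸ hqP)
    have : q ∈ (S.erase b).image ρ := by
      rw [him, mem_Icc, card_erase_of_mem hb]
      have := mem_Icc.1 hq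
      omega
    obtain ⟨a, ha, rfl⟩ := mem_image.1 this
    obtain ⟨hab, ha⟩ := mem_erase.1 ha
    exact mem_inter.2 ⟨hqP, mem_image.2 ⟨a, ha, Function.update_of_ne hab _ _⟩⟩
  · exact mem_inter.2 ⟨h₂, mem_image.2 ⟨b, hb, Function.update_self ..⟩⟩

lemma prefixBases_eq_iff {n : ℕ} (π σ : Equiv.Perm (Fin n)) {P : Finset ℕ} (hP : P ⊆ Icc 1 n) :
    prefixBases σ P = prefixBases π P ↔
      ∀ q, q ∉ P → q + 1 ∈ P → piPrefix σ q = piPrefix π q := by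
  constructor
  · intro h q hq hq'
    have hqn : q ≤ n := by
      have := (mem_Icc.1 (hP hq')).2
      omega
    have hc := card_piPrefix σ hqn
    by_contra hne
    obtain ⟨J, hJ, hlt⟩ := exists_prefixBases_card_inter_gt π hP (piPrefix σ q)
      (by rwa [hc]) (by rwa [hc]) (by rwa [hc])
    rw [hc] at hlt
    rw [← h] at hJ
    exact absurd ((mem_prefixBases.1 hJ).2 q) (by omega)
  · have key : ∀ π σ : Equiv.Perm (Fin n),
        (∀ q, q ∉ P → q + 1 ∈ P → piPrefix σ q = piPrefix π q) →
        prefixBases σ P ⊆ prefixBases π P := by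
      intro π σ h J hJ
      obtain ⟨hcard, hJ⟩ := mem_prefixBases.1 hJ
      have hlast : ∀ d q, n ≤ q + d → q ∉ P →
          (J ∩ piPrefix π q).card ≤ (P ∩ Icc 1 q).card := by
        intro d
        induction d with
        | zero =>
          intro q hq _
          rw [add_zero] at hq
          rw [inter_eq_left.2 (hP.trans (Icc_subset_Icc_right hq)), ← hcard]
          exact card_le_card inter_subset_left
        | succ d ih =>
          intro q hq hqP
          by_cases hq' : q + 1 ∈ P
          · rw [← h q hqP hq']
            exact hJ q
          · have h1 := ih (q + 1) (by omega) hq'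
            rw [card_inter_Icc_succ, if_neg hq', add_zero] at h1
            refine (card_le_card (inter_subset_inter_left ?_)).trans h1
            intro a
            simp only [mem_piPrefix]
            omega
      refine mem_prefixBases.2 ⟨hcard, fun q => ?_⟩
      induction q with
      | zero => exact hlast n 0 (by omega) fun h => by simpa using hP h
      | succ q ih =>
        by_cases hq : q + 1 ∈ P
        · rw [card_inter_Icc_succ, if_pos hq]
          exact (card_inter_piPrefix_succ_le π J q).trans (by omega)
        · exact hlast n (q + 1) (by omega) hq
    exact fun h => (key π σ h).antisymm (key σ π fun q h₁ h₂ => (h q h₁ h₂).symm)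

lemma prefixBases_cogirth_iff {n k : ℕ} (hkn : k ≤ n) (π : Equiv.Perm (Fin n)) {P : Finset ℕ}
    (hP : P ⊆ Icc 1 n) :
    (∀ S : Finset (Fin n), k ≤ S.card → ∃ J ∈ prefixBases π P, J ⊆ S) ↔ P ⊆ Icc 1 k := by
  constructor
  · intro h
    obtain ⟨J, hJ, hJS⟩ := h (piPrefix π k) (card_piPrefix π hkn).ge
    obtain ⟨hcard, hJ⟩ := mem_prefixBases.1 hJ
    have h1 := hJ k
    rw [inter_eq_left.2 hJS, hcard] at h1
    exact inter_eq_left.1 (eq_of_subset_of_card_le inter_subset_left h1)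
  · intro h S hS
    obtain ⟨J, hJ, hle⟩ := exists_prefixBases_card_inter_ge_card π hP S
    rw [inter_eq_left.2 (h.trans (Icc_subset_Icc_right hS)),
      ← (mem_prefixBases.1 hJ).1] at hle
    exact ⟨J, hJ, inter_eq_left.1 (eq_of_subset_of_card_le inter_subset_left hle)⟩

lemma prod_factorial_card_countP (N prev : ℕ) (l : List ℕ)
    (hl : (prev :: l).Pairwise (· ≤ ·)) (hN : ∀ x ∈ l, x ≤ N) :
    ∏ j ∈ range (l.length + 1),
        ((Ico prev N).filter fun i => l.countP (fun x => x ≤ i) = j).card.factorial =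
      ((diffList N prev l).map Nat.factorial).prod := by
  induction l generalizing prev with
  | nil => simp [diffList]
  | cons m l ih =>
    rw [List.pairwise_cons] at hl
    have hm : prev ≤ m := hl.1 m (by simp)
    have hmN : m ≤ N := hN m (by simp)
    have hml : ∀ x ∈ l, m ≤ x := (List.pairwise_cons.1 hl.2).1
    rw [List.length_cons, prod_range_succ', diffList, List.map_cons, List.prod_cons,
      ← ih m hl.2 fun x hx => hN x (by simp [hx]), mul_comm]
    congr 2
    · have : ((Ico prev N).filter fun i => (m :: l).countP (fun x => x ≤ i) = 0) = Ico prev m := by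
        ext i
        simp only [mem_filter, mem_Ico, List.countP_eq_zero, decide_eq_true_eq, not_le,
          List.forall_mem_cons]
        constructor
        · rintro ⟨h₁, h₂, -⟩
          exact ⟨h₁.1, h₂⟩
        · rintro ⟨h₁, h₂⟩
          exact ⟨⟨h₁, h₂.trans_le hmN⟩, h₂, fun x hx => h₂.trans_le (hml x hx)⟩
      rw [this, Nat.card_Ico]
    · funext j
      congr 2
      ext i
      simp only [mem_filter, mem_Ico, List.countP_cons, decide_eq_true_eq]
      constructor
      · rintro ⟨h₁, h₂⟩
        have hmi : m ≤ i := by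
          by_contra! hlt
          have h0 : l.countP (fun x => x ≤ i) = 0 := by
            rw [List.countP_eq_zero]
            intro x hx
            have := hml x hx
            simp only [decide_eq_true_eq]
            omega
          rw [h0, if_neg (by omega)] at h₂
          omega
        rw [if_pos hmi] at h₂
        exact ⟨⟨hmi, h₁.2⟩, by omega⟩
      · rintro ⟨h₁, h₂⟩
        rw [if_pos h₁.1, h₂]
        exact ⟨⟨hm.trans h₁.1, h₁.2⟩, rfl⟩

lemma countP_le_eq_iff {l : List ℕ} {x y : ℕ} :
    l.countP (fun m => m ≤ x) = l.countP (fun m => m ≤ y) ↔ ∀ m ∈ l, m ≤ x ↔ m ≤ y := by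
  refine ⟨fun h => ?_, fun h => List.countP_congr fun m hm => by simpa using h m hm⟩
  have key : ∀ x y : ℕ, x ≤ y → ∀ l : List ℕ,
      l.countP (fun m => m ≤ x) = l.countP (fun m => m ≤ y) → ∀ m ∈ l, m ≤ y → m ≤ x := by
    intro x y hxy l
    induction l with
    | nil => simp
    | cons m l ih =>
      intro h
      have hmono : l.countP (fun m => m ≤ x) ≤ l.countP (fun m => m ≤ y) :=
        List.countP_mono_left fun m _ hm => by
          simp only [decide_eq_true_eq] at hm ⊢
          omega
      simp only [List.countP_cons, decide_eq_true_eq] at h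
      rw [List.forall_mem_cons]
      split_ifs at h with h₁ h₂ h₂
      · exact ⟨fun _ => h₁, ih (by omega)⟩
      · omega
      · omega
      · exact ⟨fun h' => absurd h' h₂, ih (by omega)⟩
  intro m hm
  rcases le_total x y with hxy | hxy
  · exact ⟨fun h' => h'.trans hxy, key x y hxy l h m hm⟩
  · exact ⟨key y x hxy l h.symm m hm, fun h' => h'.trans hxy⟩

lemma mem_blockMinima {P : Finset ℕ} {m : ℕ} : m ∈ blockMinima P ↔ m ∈ P ∧ m - 1 ∉ P := by
  simp [blockMinima]

lemma prefixBases_eq_iff_countP {n : ℕ} (π σ : Equiv.Perm (Fin n)) {P : Finset ℕ}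
    (hP : P ⊆ Icc 1 n) :
    prefixBases σ P = prefixBases π P ↔
      ∀ a, (blockMinima P).countP (fun m => m ≤ piPos σ a) =
        (blockMinima P).countP (fun m => m ≤ piPos π a) := by
  simp only [prefixBases_eq_iff π σ hP, countP_le_eq_iff, mem_blockMinima]
  constructor
  · rintro h a m ⟨hm, hm'⟩
    have h1 := (mem_Icc.1 (hP hm)).1
    obtain ⟨q, rfl⟩ := Nat.exists_eq_add_of_le' h1
    have := Finset.ext_iff.1 (h q hm' hm) a
    simp only [mem_piPrefix] at this
    omega
  · intro h q hq hq'
    ext a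
    have := h a (q + 1) ⟨hq', hq⟩
    simp only [mem_piPrefix]
    omega

lemma card_filter_prefixBases_eq {n : ℕ} (π : Equiv.Perm (Fin n)) {P : Finset ℕ}
    (hP : P ⊆ Icc 1 n) :
    (univ.filter fun σ => prefixBases σ P = prefixBases π P).card =
      ((diffList (n + 1) 1 (blockMinima P)).map Nat.factorial).prod := by
  set l := blockMinima P with hl
  let f : Fin n → Fin (l.length + 1) := fun i =>
    ⟨l.countP (fun m => m ≤ (i : ℕ) + 1), Nat.lt_succ_of_le List.countP_le_length⟩
  have hmem : ∀ m ∈ l, 1 ≤ m ∧ m ≤ n := fun m hm => mem_Icc.1 (hP (mem_blockMinima.1 hm).1)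
  have hiff : ∀ σ : Equiv.Perm (Fin n),
      prefixBases σ P = prefixBases π P ↔ f ∘ (σ⁻¹ * π : Equiv.Perm (Fin n)) = f := by
    intro σ
    rw [prefixBases_eq_iff_countP π σ hP, funext_iff, ← π.forall_congr_right]
    simp [f, piPos, Fin.ext_iff, ← hl, Equiv.Perm.inv_def]
    rfl
  rw [← prod_factorial_card_countP (n + 1) 1 l
      (List.pairwise_cons.2 ⟨fun m hm => (hmem m hm).1, pairwise_sort _ _⟩)
      fun m hm => (hmem m hm).2.trans n.le_succ,
    ← Fintype.card_subtype,
    Fintype.card_congr (((Equiv.inv _).trans (Equiv.mulRight π)).subtypeEquiv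
      (q := fun g : Equiv.Perm (Fin n) => f ∘ g = f) hiff),
    DomMulAct.stabilizer_card, ← Fin.prod_univ_eq_prod_range
      (fun j => ((Ico 1 (n + 1)).filter fun i => l.countP (fun x => x ≤ i) = j).card.factorial)]
  refine prod_congr rfl fun j _ => ?_
  rw [Fintype.card_subtype]
  congr 1
  refine card_bij (fun a _ => (a : ℕ) + 1) ?_ ?_ ?_
  · intro a ha
    simpa [f, Fin.ext_iff] using ha
  · intro a _ b _ h
    exact Fin.ext (by omega)
  · intro i hi
    simp only [mem_filter, mem_Ico] at hi
    refine ⟨⟨i - 1, by omega⟩, ?_, by simp only; omega⟩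
    have : i - 1 + 1 = i := by omega
    simpa [f, Fin.ext_iff, this] using hi.2

lemma card_image_prefixBases {n : ℕ} {P : Finset ℕ} (hP : P ⊆ Icc 1 n) :
    (univ.image fun π : Equiv.Perm (Fin n) => prefixBases π P).card = binomDelta n P := by
  have h := card_eq_sum_card_image (fun π : Equiv.Perm (Fin n) => prefixBases π P) univ
  rw [sum_congr rfl (g := fun _ => ((diffList (n + 1) 1 (blockMinima P)).map Nat.factorial).prod),
    sum_const, smul_eq_mul, card_univ, Fintype.card_perm, Fintype.card_fin] at h
  · refine (Nat.div_eq_of_eq_mul_left (List.prod_pos ?_) h).symm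
    intro x hx
    obtain ⟨y, _, rfl⟩ := List.mem_map.1 hx
    exact y.factorial_pos
  · intro B hB
    obtain ⟨π, _, rfl⟩ := mem_image.1 hB
    exact card_filter_prefixBases_eq π hP

/-- For `1 ≤ k ≤ n` and `0 ≤ m ≤ k`, the number of distinct Schubert
matroids on `[n]` of rank `m` and cogirth greater than `n - k` (distinct base families
`B_{I,π}` over all `I` with `|I| = m` — for `I = ∅` the family is `{∅}` — such that every
subset of cardinality at least `k` contains a member) equals
`Σ_{I ⊆ {1,…,k}, |I| = m} binom(n, ΔI)`, the coefficient of `x^m` in the augmented Chow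
polynomial of the uniform matroid `U_{k,n}`. -/
theorem card_schubert_rank_cogirth (n k m : ℕ) (hk : 1 ≤ k) (hkn : k ≤ n)
    (hm : m ≤ k) :
    {B : Finset (Finset (Fin n)) |
        (∃ (I : Finset (Fin n)) (π : Equiv.Perm (Fin n)),
            I.card = m ∧ B = schubertBases π I)
        ∧ (∀ S : Finset (Fin n), k ≤ S.card → ∃ J ∈ B, J ⊆ S)}.ncard
      = ∑ I ∈ (Finset.Icc 1 k).powerset.filter (fun I => I.card = m),
          binomDelta n I := by
  have hset : {B : Finset (Finset (Fin n)) |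
        (∃ (I : Finset (Fin n)) (π : Equiv.Perm (Fin n)),
            I.card = m ∧ B = schubertBases π I)
        ∧ (∀ S : Finset (Fin n), k ≤ S.card → ∃ J ∈ B, J ⊆ S)} =
      (((Finset.Icc 1 k).powerset.filter (fun I => I.card = m)).biUnion fun P =>
        univ.image fun π : Equiv.Perm (Fin n) => prefixBases π P :
        Finset (Finset (Finset (Fin n)))) := by
    ext B
    simp only [Set.mem_ofPred_eq, coe_biUnion, Set.mem_iUnion, mem_coe, mem_filter, mem_powerset,
      mem_image, mem_univ, true_and, exists_prop]
    constructor
    · rintro ⟨⟨I, π, rfl, rfl⟩, h⟩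
      rw [schubertBases_eq_prefixBases] at h ⊢
      exact ⟨_, ⟨(prefixBases_cogirth_iff hkn π (image_piPos_subset π I)).1 h,
        card_image_of_injective _ (piPos_injective π)⟩, π, rfl⟩
    · rintro ⟨P, ⟨hP, rfl⟩, π, rfl⟩
      have hPn := hP.trans (Icc_subset_Icc_right hkn)
      obtain ⟨I, rfl⟩ := exists_image_piPos_eq π hPn
      exact ⟨⟨I, π, (card_image_of_injective _ (piPos_injective π)).symm,
        (schubertBases_eq_prefixBases π I).symm⟩, (prefixBases_cogirth_iff hkn π hPn).2 hP⟩
  have hsub : ∀ P ∈ (Finset.Icc 1 k).powerset.filter (fun I => I.card = m), P ⊆ Icc 1 n :=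
    fun P hP => (mem_powerset.1 (mem_filter.1 hP).1).trans (Icc_subset_Icc_right hkn)
  rw [hset, Set.ncard_coe_finset, card_biUnion]
  · exact sum_congr rfl fun P hP => card_image_prefixBases (hsub P hP)
  · intro P hP Q hQ hPQ
    refine disjoint_left.2 fun B hB hB' => hPQ ?_
    obtain ⟨π, _, rfl⟩ := mem_image.1 hB
    obtain ⟨σ, _, h⟩ := mem_image.1 hB'
    exact eq_of_prefixBases_eq (hsub P hP) (hsub Q hQ) h.symm
end

section
/- For integers 1 ≤ k ≤ n, the following polynomial identity holds in ℤ[x]: Σ_{I ⊆ {1,…,k}, 1 ∈ I} binom(n, ΔI) · x^{|I|−1} = Σ_{j=0}^{k−1} binom(n, j) · d_j(x) · (1 + x + … + x^{k−1−j}), where d_j(x) = Σ_{w ∈ D_j} x^{exc(w)} is the j-th derangement polynomial (d_0(x) = 1). (Both sides equal the Chow polynomial of the uniform matroid U_{k,n}.) -/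
open Finset Polynomial

/-- One-line notation: `oneline n w i = w(i)` for `i ∈ {1,…,n}`, with values in `{1,…,n}`. -/
def oneline (n : ℕ) (w : Equiv.Perm (Fin n)) (i : ℕ) : ℕ :=
  if h : i - 1 < n then (w ⟨i - 1, h⟩ : ℕ) + 1 else 0

/-- The descent set `Des(w) ⊆ {1,…,n-1}` of a permutation `w` of `{1,…,n}`:
positions `i` with `w(i) > w(i+1)`. -/
def descSet (n : ℕ) (w : Equiv.Perm (Fin n)) : Finset ℕ :=
  (Finset.Ico 1 n).filter fun i => oneline n w (i + 1) < oneline n w i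

/-- `E(n, D)`: the number of permutations of `{1,…,n}` with descent set exactly `D`. -/
def eulerianCount (n : ℕ) (D : Finset ℕ) : ℕ :=
  (Finset.univ.filter fun w : Equiv.Perm (Fin n) => descSet n w = D).card

/-- The `j`-th derangement polynomial `d_j(x) = Σ_{w ∈ D_j} x^{exc w}`, where `D_j` is the
set of fixed-point-free permutations in `S_j` and `exc w = #{i : w(i) > i}`. -/
noncomputable def derangementPoly (j : ℕ) : Polynomial ℤ :=
  ∑ w ∈ (Finset.univ : Finset (Equiv.Perm (Fin j))).filter (fun w => ∀ i, w i ≠ i),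
    X ^ (Finset.univ.filter fun i => i < w i).card

/-- The permutations moving exactly the points of `S`, weighted by excedances, are enumerated by
the derangement polynomial of `S.card`. -/
theorem sum_exc_of_moved_eq {n : ℕ} (S : Finset (Fin n)) :
    ∑ w : Equiv.Perm (Fin n) with (univ.filter fun i => w i ≠ i) = S,
      (X : ℤ[X]) ^ (univ.filter fun i => i < w i).card = derangementPoly S.card := by
  set e := S.orderIsoOfFin rfl with he
  have himg : ∀ (f : Equiv.Perm (Fin S.card)) (a : Fin S.card),
      f.extendDomain e.toEquiv (e a : Fin n) = (e (f a) : Fin n) := fun f a =>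
    f.extendDomain_apply_image e.toEquiv a
  have hout : ∀ (f : Equiv.Perm (Fin S.card)) (i : Fin n), i ∉ S →
      f.extendDomain e.toEquiv i = i := fun f i hi =>
    f.extendDomain_apply_not_subtype e.toEquiv hi
  have hin : ∀ i ∈ S, ∃ a, (e a : Fin n) = i := fun i hi =>
    ⟨e.symm ⟨i, hi⟩, by simp⟩
  unfold derangementPoly
  symm
  refine Finset.sum_nbij (fun f => f.extendDomain e.toEquiv) ?_ ?_ ?_ ?_
  · intro f hf
    simp only [mem_filter, mem_univ, true_and] at hf ⊢
    ext i
    simp only [mem_filter, mem_univ, true_and]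
    by_cases hi : i ∈ S
    · obtain ⟨a, rfl⟩ := hin i hi
      rw [himg]
      simp [hf a]
    · simp [hi, hout f i hi]
  · intro f _ g _ hfg
    ext a : 1
    have h := DFunLike.congr_fun hfg (e a : Fin n)
    simp only [himg] at h
    exact e.injective (Subtype.ext h)
  · intro w hw
    simp only [coe_filter, mem_univ, true_and, Set.mem_ofPred_eq] at hw
    have hmem : ∀ i, i ∈ S ↔ w i ≠ i := fun i => by rw [← hw]; simp
    have hS : ∀ i, w i ∈ S ↔ i ∈ S := fun i => by
      rw [hmem, hmem]; simp
    refine ⟨e.toEquiv.permCongr.symm (w.subtypePerm hS), ?_, ?_⟩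
    · simp only [coe_filter, mem_univ, true_and, Set.mem_ofPred_eq]
      intro a ha
      have h := congrArg (fun b => (e b : Fin n)) ha
      simp at h
      exact (hmem _).1 (e a).2 h
    · ext i : 1
      by_cases hi : i ∈ S
      · obtain ⟨a, rfl⟩ := hin i hi
        simp only [himg]
        simp
      · simp only [hout _ i hi]
        by_contra h
        exact hi ((hmem i).2 (Ne.symm h))
  · intro f _
    congr 1
    refine Finset.card_nbij (fun a => (e a : Fin n)) ?_ ?_ ?_
    · intro a ha
      simpa [himg] using ha
    · intro a _ b _ h
      exact e.injective (Subtype.ext h)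
    · intro i hi
      simp only [coe_filter, mem_univ, true_and, Set.mem_ofPred_eq] at hi
      by_cases hiS : i ∈ S
      · obtain ⟨a, rfl⟩ := hin i hiS
        exact ⟨a, by simpa [himg] using hi, rfl⟩
      · rw [hout f i hiS] at hi
        exact absurd hi (lt_irrefl _)

theorem sum_fix_exc (n : ℕ) (y : ℤ[X]) :
    ∑ w : Equiv.Perm (Fin n), y ^ (univ.filter fun i => w i = i).card *
      X ^ (univ.filter fun i => i < w i).card =
    ∑ j ∈ range (n + 1), (n.choose j : ℤ[X]) * derangementPoly j * y ^ (n - j) := by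
  have hfix : ∀ w : Equiv.Perm (Fin n), (univ.filter fun i => w i = i).card =
      n - (univ.filter fun i => w i ≠ i).card := fun w => by
    have := card_filter_add_card_filter_not (s := (univ : Finset (Fin n))) (fun i => w i = i)
    simp only [card_univ, Fintype.card_fin] at this
    simp only [ne_eq]
    omega
  rw [← Finset.sum_fiberwise univ (fun w : Equiv.Perm (Fin n) => univ.filter fun i => w i ≠ i)]
  calc _ = ∑ S ∈ (univ : Finset (Fin n)).powerset, y ^ (n - S.card) * derangementPoly S.card := by
        rw [powerset_univ]
        refine sum_congr rfl fun S _ => ?_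
        rw [← sum_exc_of_moved_eq, mul_sum]
        refine sum_congr rfl fun w hw => ?_
        rw [hfix, (mem_filter.1 hw).2]
    _ = _ := by
        rw [sum_powerset_apply_card (fun j => y ^ (n - j) * derangementPoly j)]
        simp only [card_univ, Fintype.card_fin, nsmul_eq_mul]
        exact sum_congr rfl fun j _ => by ring

/-- Composing with the cyclic shift turns weak excedances into excedances, up to one. -/
theorem card_exc_finRotate_mul (m : ℕ) (w : Equiv.Perm (Fin (m + 1))) :
    (univ.filter fun i => i < (finRotate (m + 1) * w) i).card + 1 =
      (univ.filter fun i => i ≤ w i).card := by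
  have h : (univ.filter fun i => i ≤ w i) =
      insert (w⁻¹ (Fin.last m)) (univ.filter fun i => i < (finRotate (m + 1) * w) i) := by
    ext i
    simp only [mem_filter, mem_univ, true_and, mem_insert,
      Equiv.Perm.eq_inv_iff_eq]
    rw [Equiv.Perm.mul_apply]
    by_cases hi : w i = Fin.last m
    · simp [hi, Fin.le_last]
    · rw [or_iff_right hi, Fin.le_def, Fin.lt_def, coe_finRotate_of_ne_last hi]
      omega
  rw [h, card_insert_of_notMem]
  simp

theorem sum_weak_exc (m : ℕ) :
    ∑ w : Equiv.Perm (Fin (m + 1)), (X : ℤ[X]) ^ (univ.filter fun i => w i = i).card *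
      X ^ (univ.filter fun i => i < w i).card =
    X * ∑ w : Equiv.Perm (Fin (m + 1)), X ^ (univ.filter fun i => i < w i).card := by
  rw [← Equiv.sum_comp (Equiv.mulLeft (finRotate (m + 1))) fun w : Equiv.Perm (Fin (m + 1)) =>
    (X : ℤ[X]) ^ (univ.filter fun i => i < w i).card, mul_sum]
  refine sum_congr rfl fun w _ => ?_
  rw [Equiv.coe_mulLeft, ← pow_succ', card_exc_finRotate_mul, ← pow_add,
    ← card_union_of_disjoint]
  · congr 2
    ext i
    simp [le_iff_eq_or_lt, eq_comm]
  · exact disjoint_filter.2 fun i _ h => by simp [h]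

theorem derangementPoly_succ (m : ℕ) :
    derangementPoly (m + 1) = X * ∑ j ∈ range m,
      ((m + 1).choose j : ℤ[X]) * derangementPoly j * ∑ t ∈ range (m - j), X ^ t := by
  have h := sum_weak_exc m
  have h1 := sum_fix_exc (m + 1) 1
  simp only [one_pow, one_mul, mul_one] at h1
  rw [sum_fix_exc, h1, sum_range_succ, sum_range_succ, sum_range_succ _ (m + 1),
    sum_range_succ _ m] at h
  have h2 : ∑ j ∈ range m, ((m + 1).choose j : ℤ[X]) * derangementPoly j * X ^ (m + 1 - j) =
      X * ∑ j ∈ range m, ((m + 1).choose j : ℤ[X]) * derangementPoly j +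
      (X - 1) * (X * ∑ j ∈ range m,
        ((m + 1).choose j : ℤ[X]) * derangementPoly j * ∑ t ∈ range (m - j), X ^ t) := by
    simp only [mul_sum (range m), ← sum_add_distrib]
    refine sum_congr rfl fun j hj => ?_
    have hg := mul_geom_sum (X : ℤ[X]) (m - j)
    rw [Nat.sub_add_comm (mem_range.1 hj).le, pow_succ]
    linear_combination (-((m + 1).choose j : ℤ[X]) * derangementPoly j * X) * hg
  rw [h2] at h
  have hX : (X - 1 : ℤ[X]) ≠ 0 := by simpa using X_sub_C_ne_zero (1 : ℤ)
  apply mul_left_cancel₀ hX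
  simp at h
  linear_combination -h

theorem diffList_append (N m : ℕ) (l : List ℕ) (p : ℕ) :
    diffList N p (l ++ [m]) = diffList m p l ++ [N - m] := by
  induction l generalizing p with
  | nil => rfl
  | cons a l ih => simp [diffList, ih]

theorem prod_factorial_diffList_dvd (N : ℕ) (l : List ℕ) (p : ℕ)
    (hl : (p :: l).Pairwise (· ≤ ·)) (hN : ∀ a ∈ p :: l, a ≤ N) :
    ((diffList N p l).map Nat.factorial).prod ∣ (N - p).factorial := by
  induction l generalizing p with
  | nil => simp [diffList]
  | cons a l ih =>
    have h := ih a (List.pairwise_cons.1 hl).2 fun b hb => hN b (List.mem_cons_of_mem _ hb)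
    have hpa : p ≤ a := (List.pairwise_cons.1 hl).1 a (by simp)
    have haN : a ≤ N := hN a (by simp)
    simp only [diffList, List.map_cons, List.prod_cons]
    refine (Nat.mul_dvd_mul_left _ h).trans ?_
    have h' := Nat.factorial_mul_factorial_dvd_factorial_add (a - p) (N - a)
    rwa [show a - p + (N - a) = N - p by omega] at h'

theorem blockMinima_insert_of_mem {I : Finset ℕ} {k : ℕ} (hk : k ∈ I) (hI : ∀ i ∈ I, i ≤ k) :
    blockMinima (insert (k + 1) I) = blockMinima I := by
  unfold blockMinima
  congr 1
  ext i
  simp only [mem_filter, mem_insert]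
  constructor
  · rintro ⟨rfl | hi, h⟩
    · simp [hk] at h
    · exact ⟨hi, fun h' => h (Or.inr h')⟩
  · rintro ⟨hi, h⟩
    have := hI i hi
    exact ⟨Or.inr hi, by rintro (h' | h'); exacts [by omega, h h']⟩

theorem blockMinima_insert_of_lt {I : Finset ℕ} {k : ℕ} (hI : ∀ i ∈ I, i < k) :
    blockMinima (insert (k + 1) I) = blockMinima I ++ [k + 1] := by
  have hnot : k + 1 ∉ I := fun h => by have := hI _ h; omega
  have hset : (insert (k + 1) I).filter (fun i => i - 1 ∉ insert (k + 1) I) =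
      insert (k + 1) (I.filter fun i => i - 1 ∉ I) := by
    ext i
    simp only [mem_filter, mem_insert]
    constructor
    · rintro ⟨rfl | hi, h⟩
      · exact Or.inl rfl
      · exact Or.inr ⟨hi, fun h' => h (Or.inr h')⟩
    · rintro (rfl | ⟨hi, h⟩)
      · refine ⟨Or.inl rfl, ?_⟩
        rintro (h' | h')
        · omega
        · have := hI _ h'
          omega
      · have := hI i hi
        exact ⟨Or.inr hi, by rintro (h' | h'); exacts [by omega, h h']⟩
  unfold blockMinima
  rw [hset]
  refine List.Perm.eq_of_pairwise (le := (· ≤ ·)) (fun a b _ _ => le_antisymm)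
    (pairwise_sort _ _) ?_ ?_
  · rw [List.pairwise_append]
    refine ⟨pairwise_sort _ _, List.pairwise_singleton _ _, fun a ha b hb => ?_⟩
    rw [mem_sort, mem_filter] at ha
    have := hI a ha.1
    rw [List.mem_singleton.1 hb]
    omega
  · rw [← Multiset.coe_eq_coe, ← Multiset.coe_add, sort_eq, sort_eq,
      insert_val_of_notMem (by simp [hnot]), Multiset.coe_singleton,
      add_comm (Finset.val _), Multiset.singleton_add]

theorem binomDelta_insert_of_mem (n : ℕ) {I : Finset ℕ} {k : ℕ} (hk : k ∈ I)
    (hI : ∀ i ∈ I, i ≤ k) : binomDelta n (insert (k + 1) I) = binomDelta n I := by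
  rw [binomDelta, blockMinima_insert_of_mem hk hI, binomDelta]

theorem binomDelta_insert_of_lt {n k : ℕ} (hkn : k ≤ n) {I : Finset ℕ}
    (hI : ∀ i ∈ I, 1 ≤ i ∧ i < k) :
    binomDelta n (insert (k + 1) I) = n.choose k * binomDelta k I := by
  have hdvd : ((diffList (k + 1) 1 (blockMinima I)).map Nat.factorial).prod ∣ k.factorial := by
    have hmem : ∀ a ∈ blockMinima I, 1 ≤ a ∧ a < k := fun a ha =>
      hI a (mem_filter.1 ((mem_sort _).1 ha)).1
    refine prod_factorial_diffList_dvd (k + 1) (blockMinima I) 1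
      (List.pairwise_cons.2 ⟨fun a ha => (hmem a ha).1, pairwise_sort _ _⟩) ?_
    intro a ha
    rcases List.mem_cons.1 ha with rfl | ha
    · omega
    · have := hmem a ha
      omega
  rw [binomDelta, blockMinima_insert_of_lt fun i hi => (hI i hi).2, diffList_append, binomDelta,
    ← Nat.mul_div_assoc _ hdvd, List.map_append, List.prod_append, mul_comm,
    ← Nat.div_div_eq_div_mul]
  congr 1
  simp only [List.map_cons, List.map_nil, List.prod_singleton, Nat.add_sub_add_right]
  rw [← Nat.choose_mul_factorial_mul_factorial hkn, Nat.mul_div_cancel _ (Nat.factorial_pos _)]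

/-- The subsets of `{1,…,k}` containing `1`. -/
def subsetsWithOne (k : ℕ) : Finset (Finset ℕ) :=
  (Icc 1 k).powerset.filter fun I => 1 ∈ I

theorem mem_subsetsWithOne {k : ℕ} {I : Finset ℕ} :
    I ∈ subsetsWithOne k ↔ (∀ i ∈ I, 1 ≤ i ∧ i ≤ k) ∧ 1 ∈ I := by
  simp [subsetsWithOne, subset_iff]

theorem sum_subsetsWithOne_succ {k : ℕ} (hk : 1 ≤ k) (f : Finset ℕ → ℤ[X]) :
    ∑ I ∈ subsetsWithOne (k + 1), f I =
      ∑ I ∈ subsetsWithOne k, f I + ∑ I ∈ subsetsWithOne k, f (insert (k + 1) I) := by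
  have hne : k ≠ 0 := by omega
  simp only [subsetsWithOne, sum_filter]
  rw [← insert_Icc_right_eq_Icc_add_one (by omega : 1 ≤ k + 1), sum_powerset_insert (by simp)]
  simp [hne]

theorem sum_subsetsWithOne_one (f : Finset ℕ → ℤ[X]) :
    ∑ I ∈ subsetsWithOne 1, f I = f {1} := by
  have h : subsetsWithOne 1 = {{1}} := by decide
  rw [h, sum_singleton]

/-- The weight of `I` in the Chow polynomial. -/
noncomputable def chowTerm (n : ℕ) (I : Finset ℕ) : ℤ[X] :=
  (binomDelta n I : ℤ[X]) * X ^ (I.card - 1)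

theorem chowTerm_singleton_one (n : ℕ) : chowTerm n {1} = 1 := by
  have h : blockMinima {1} = [1] := by
    have : ({1} : Finset ℕ).filter (fun i => i - 1 ∉ ({1} : Finset ℕ)) = {1} := by decide
    rw [blockMinima, this, sort_singleton]
  simp [chowTerm, binomDelta, h, diffList, Nat.div_self (Nat.factorial_pos n)]

theorem chowTerm_insert_of_mem (n : ℕ) {I : Finset ℕ} {k : ℕ} (hk : k ∈ I)
    (hI : ∀ i ∈ I, i ≤ k) : chowTerm n (insert (k + 1) I) = X * chowTerm n I := by
  have hnot : k + 1 ∉ I := fun h => by have := hI _ h; omega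
  have hc : I.card = I.card - 1 + 1 := by have := card_pos.2 ⟨k, hk⟩; omega
  rw [chowTerm, binomDelta_insert_of_mem n hk hI, card_insert_of_notMem hnot, chowTerm,
    Nat.add_sub_cancel]
  nth_rw 1 [hc]
  ring

theorem chowTerm_insert_of_lt {n k : ℕ} (hkn : k ≤ n) {I : Finset ℕ} (hne : I.Nonempty)
    (hI : ∀ i ∈ I, 1 ≤ i ∧ i < k) :
    chowTerm n (insert (k + 1) I) = (n.choose k : ℤ[X]) * (X * chowTerm k I) := by
  have hnot : k + 1 ∉ I := fun h => by have := hI _ h; omega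
  have hc : I.card = I.card - 1 + 1 := by have := card_pos.2 hne; omega
  rw [chowTerm, binomDelta_insert_of_lt hkn hI, card_insert_of_notMem hnot, chowTerm,
    Nat.add_sub_cancel, Nat.cast_mul]
  nth_rw 1 [hc]
  ring

theorem sum_chowTerm_insert_succ {n k : ℕ} (hk : 1 ≤ k) (hkn : k + 1 ≤ n) :
    ∑ I ∈ subsetsWithOne (k + 1), chowTerm n (insert (k + 1 + 1) I) =
      (n.choose (k + 1) : ℤ[X]) * (X * ∑ I ∈ subsetsWithOne k, chowTerm (k + 1) I) +
      X * ∑ I ∈ subsetsWithOne k, chowTerm n (insert (k + 1) I) := by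
  rw [sum_subsetsWithOne_succ hk]
  simp only [mul_sum]
  congr 1 <;> refine sum_congr rfl fun I hI => ?_ <;> rw [mem_subsetsWithOne] at hI
  · exact chowTerm_insert_of_lt hkn ⟨1, hI.2⟩ fun i hi =>
      ⟨(hI.1 i hi).1, Nat.lt_succ_of_le (hI.1 i hi).2⟩
  · refine chowTerm_insert_of_mem n (mem_insert_self _ _) fun i hi => ?_
    rcases mem_insert.1 hi with rfl | hi
    · exact le_rfl
    · exact (hI.1 i hi).2.trans (Nat.le_succ k)

theorem sum_mul_geom_sum_succ (a : ℕ → ℤ[X]) (k : ℕ) :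
    ∑ j ∈ range (k + 1), a j * ∑ t ∈ range (k + 1 - j), X ^ t =
      ∑ j ∈ range k, a j * ∑ t ∈ range (k - j), X ^ t +
      ∑ j ∈ range (k + 1), a j * X ^ (k - j) := by
  rw [sum_range_succ, sum_range_succ (fun j => a j * X ^ (k - j)), ← add_assoc,
    ← sum_add_distrib]
  congr 1
  · refine sum_congr rfl fun j hj => ?_
    rw [Nat.sub_add_comm (mem_range.1 hj).le, sum_range_succ, mul_add]
  · simp

theorem derangementPoly_zero : derangementPoly 0 = 1 := by
  simp [derangementPoly]

theorem derangementPoly_one : derangementPoly 1 = 0 := by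
  simp [derangementPoly_succ 0]

theorem sum_chowTerm {k : ℕ} (hk : 1 ≤ k) :
    (∀ n, k ≤ n → ∑ I ∈ subsetsWithOne k, chowTerm n I = ∑ j ∈ range k,
      (n.choose j : ℤ[X]) * derangementPoly j * ∑ t ∈ range (k - j), X ^ t) ∧
    ∀ n, k ≤ n → ∑ I ∈ subsetsWithOne k, chowTerm n (insert (k + 1) I) =
      ∑ j ∈ range (k + 1), (n.choose j : ℤ[X]) * derangementPoly j * X ^ (k - j) := by
  induction k, hk using Nat.le_induction with
  | base =>
    refine ⟨fun n _ => ?_, fun n _ => ?_⟩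
    · simp [sum_subsetsWithOne_one, chowTerm_singleton_one, derangementPoly_zero]
    · rw [sum_subsetsWithOne_one, chowTerm_insert_of_mem n (by simp) (by simp),
        chowTerm_singleton_one]
      simp [sum_range_succ, derangementPoly_zero, derangementPoly_one]
  | succ k hk ih =>
    refine ⟨fun n hn => ?_, fun n hn => ?_⟩
    · rw [sum_subsetsWithOne_succ hk, ih.1 n (by omega), ih.2 n (by omega),
        sum_mul_geom_sum_succ]
    · rw [sum_chowTerm_insert_succ hk hn, ih.1 (k + 1) (by omega), ih.2 n (by omega),
        ← derangementPoly_succ, sum_range_succ _ (k + 1), add_comm, mul_sum]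
      congr 1
      · refine sum_congr rfl fun j hj => ?_
        rw [Nat.sub_add_comm (Nat.lt_succ_iff.1 (mem_range.1 hj))]
        ring
      · simp

/-- For `1 ≤ k ≤ n`, in `ℤ[x]`:
`Σ_{I ⊆ {1,…,k}, 1 ∈ I} binom(n, ΔI) x^{|I|-1}
  = Σ_{j=0}^{k-1} binom(n,j) d_j(x) (1 + x + ⋯ + x^{k-1-j})`. -/
theorem chow_uniform_eq_sum_derangement (n k : ℕ) (hk : 1 ≤ k) (hkn : k ≤ n) :
    ∑ I ∈ (Finset.Icc 1 k).powerset.filter (fun I => 1 ∈ I),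
      (binomDelta n I : Polynomial ℤ) * X ^ (I.card - 1)
    = ∑ j ∈ Finset.range k,
        (n.choose j : Polynomial ℤ) * derangementPoly j
          * ∑ t ∈ Finset.range (k - j), X ^ t :=
  (sum_chowTerm hk).1 n hkn
end

section
/- Let 1 ≤ k ≤ n and let P_{k,n} be the poset of all subsets of [n] of cardinality less than k together with [n] itself, ordered by inclusion (the lattice of flats of the uniform matroid U_{k,n}). Every maximal chain of P_{k,n} has the form ∅ = F_0 ⊂ F_1 ⊂ … ⊂ F_{k−1} ⊂ F_k = [n] with |F_i| = i for i < k; assign to it the label sequence (λ_1,…,λ_k) with λ_i = min(F_i ∖ F_{i−1}). Then the map sending a maximal chain to its label sequence is a bijection from the set of maximal chains of P_{k,n} onto the set of sequences (λ_1,…,λ_k) of pairwise distinct elements of [n] satisfying {1, 2, …, λ_k} ⊆ {λ_1, λ_2, …, λ_k}. -/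
open Finset

/-- A flat of the uniform matroid `U_{k,n}`: a subset of `[n]` of cardinality less than `k`,
or all of `[n]`.  These, ordered by inclusion, form the lattice of flats of `U_{k,n}`. -/
def uniformFlat (n k : ℕ) (F : Finset (Fin n)) : Prop :=
  F.card < k ∨ F = Finset.univ

/-- `A` is covered by `B` in the lattice of flats of `U_{k,n}`: `A ⊂ B` with no flat
strictly in between. -/
def flatCover (n k : ℕ) (A B : Finset (Fin n)) : Prop :=
  A ⊂ B ∧ ∀ G : Finset (Fin n), uniformFlat n k G → A ⊂ G → ¬ G ⊂ B

/-- A maximal chain (of length `l`) in the lattice of flats of `U_{k,n}`: a chain of flats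
from the minimum `∅` to the maximum `[n]` each of whose steps is a cover relation. -/
def maxChainFlats (n k l : ℕ) (F : Fin (l + 1) → Finset (Fin n)) : Prop :=
  F 0 = ∅ ∧ F (Fin.last l) = Finset.univ ∧ (∀ i, uniformFlat n k (F i))
    ∧ ∀ i : Fin l, flatCover n k (F i.castSucc) (F i.succ)

/-- The edge-label sequence of a maximal chain `∅ = F₀ ⊂ F₁ ⊂ … ⊂ F_k = [n]`:
`λ_i = min (F_i ∖ F_{i-1})`, as an element of `[n] = {1,…,n}` (so `Fin n` is identified
with `[n]` via `x ↦ x + 1`). -/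
noncomputable def labelSeq (n k : ℕ) (F : Fin (k + 1) → Finset (Fin n)) (i : Fin k) : ℕ :=
  sInf ((fun x : Fin n => (x : ℕ) + 1) '' ↑(F i.succ \ F i.castSucc))

theorem labelSeq_eq_of_isLeast {n k : ℕ} {F : Fin (k + 1) → Finset (Fin n)} {i : Fin k}
    {x : Fin n} (hx : IsLeast (↑(F i.succ \ F i.castSucc) : Set (Fin n)) x) :
    labelSeq n k F i = (x : ℕ) + 1 :=
  ((Monotone.map_isLeast (f := fun y : Fin n => (y : ℕ) + 1)
    (fun _ _ h => Nat.succ_le_succ h)) hx).csInf_eq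

theorem flatCover.card_eq_succ {n k : ℕ} {A B : Finset (Fin n)} (h : flatCover n k A B)
    (hA : A.card + 1 < k) : B.card = A.card + 1 := by
  obtain ⟨x, hxB, hxA⟩ := Finset.exists_of_ssubset h.1
  have hins : (insert x A).card = A.card + 1 := Finset.card_insert_of_notMem hxA
  have hsub : insert x A ⊆ B := Finset.insert_subset hxB h.1.subset
  have hnot := h.2 (insert x A) (Or.inl (by omega)) (Finset.ssubset_insert hxA)
  rw [← hins, Finset.eq_of_subset_of_card_le hsub]
  by_contra hlt
  exact hnot (Finset.ssubset_iff_subset_ne.2 ⟨hsub, fun he => hlt (he ▸ le_rfl)⟩)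

theorem maxChainFlats.card_eq {n k l : ℕ} {F : Fin (l + 1) → Finset (Fin n)}
    (h : maxChainFlats n k l F) (i : Fin (l + 1)) (hi : (i : ℕ) < k) :
    (F i).card = (i : ℕ) := by
  induction i using Fin.induction with
  | zero => simp [h.1]
  | succ i ih =>
    simp only [Fin.val_succ, Fin.val_castSucc] at hi ih ⊢
    have hc := ih (by omega)
    rw [(h.2.2.2 i).card_eq_succ (by omega), hc]

theorem maxChainFlats.length_eq {n k l : ℕ} (hk : 1 ≤ k) (hkn : k ≤ n)
    {F : Fin (l + 1) → Finset (Fin n)} (h : maxChainFlats n k l F) : l = k := by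
  rcases lt_trichotomy l k with hl | hl | hl
  · have := h.card_eq (Fin.last l) hl
    rw [h.2.1, Finset.card_univ, Fintype.card_fin, Fin.val_last] at this
    omega
  · exact hl
  · have hcard := h.card_eq ⟨k - 1, by omega⟩ (by simp; omega)
    have hlt := Finset.card_lt_card (h.2.2.2 ⟨k - 1, by omega⟩).1
    have hs : (⟨k - 1, by omega⟩ : Fin l).succ = (⟨k, hl⟩ : Fin l).castSucc := by
      ext; simp; omega
    simp only [Fin.castSucc_mk, hcard, hs] at hlt
    have huniv : F (⟨k, hl⟩ : Fin l).castSucc = Finset.univ :=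
      (h.2.2.1 _).resolve_left (by simp only [Fin.castSucc_mk] at hlt ⊢; omega)
    have hss := (h.2.2.2 ⟨k, hl⟩).1
    rw [huniv] at hss
    exact absurd (Finset.subset_univ _) hss.2

/-- The chain of flats of `U_{k,n}` obtained by successively adjoining the elements
`f 0, …, f (k - 2)` to `∅`, followed by `[n]`. -/
def adjoinChain {n k : ℕ} (f : Fin k → Fin n) (i : Fin (k + 1)) : Finset (Fin n) :=
  if (i : ℕ) < k then ({j | (j : ℕ) < i} : Finset (Fin k)).image f else Finset.univ

theorem adjoinChain_card {n k : ℕ} {f : Fin k → Fin n} (hf : Function.Injective f)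
    {i : Fin (k + 1)} (hi : (i : ℕ) < k) : (adjoinChain f i).card = i := by
  rw [adjoinChain, if_pos hi, Finset.card_image_of_injective _ hf]
  simp [Fin.card_filter_val_lt, hi.le]

theorem notMem_adjoinChain_castSucc {n k : ℕ} {f : Fin k → Fin n} (hf : Function.Injective f)
    (i : Fin k) : f i ∉ adjoinChain f i.castSucc := by
  simp [adjoinChain, hf.eq_iff]

theorem adjoinChain_succ {n k : ℕ} (f : Fin k → Fin n) {i : Fin k} (hi : (i : ℕ) + 1 < k) :
    adjoinChain f i.succ = insert (f i) (adjoinChain f i.castSucc) := by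
  have : ({j | (j : ℕ) < i.succ} : Finset (Fin k)) =
      insert i ({j | (j : ℕ) < i.castSucc} : Finset (Fin k)) := by
    ext j
    simp only [Finset.mem_filter_univ, Finset.mem_insert, Fin.ext_iff, Fin.val_succ,
      Fin.val_castSucc]
    omega
  rw [adjoinChain, adjoinChain, if_pos (by simpa using hi), if_pos (by simp), this,
    Finset.image_insert]

theorem maxChainFlats_adjoinChain {n k : ℕ} (hk : 1 ≤ k) {f : Fin k → Fin n}
    (hf : Function.Injective f) : maxChainFlats n k k (adjoinChain f) := by
  refine ⟨?_, by simp [adjoinChain], fun i => ?_, fun i => ?_⟩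
  · rw [← Finset.card_eq_zero, adjoinChain_card hf (by rwa [Fin.val_zero]), Fin.val_zero]
  · by_cases hi : (i : ℕ) < k
    · exact Or.inl ((adjoinChain_card hf hi).trans_lt hi)
    · exact Or.inr (if_neg hi)
  · have hnot := notMem_adjoinChain_castSucc hf i
    have hcard := adjoinChain_card hf (i := i.castSucc) i.2
    by_cases hi : (i : ℕ) + 1 < k
    · rw [adjoinChain_succ f hi]
      refine ⟨Finset.ssubset_insert hnot, fun G _ hAG hGB => ?_⟩
      have h₁ := Finset.card_lt_card hAG
      have h₂ := Finset.card_lt_card hGB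
      rw [Finset.card_insert_of_notMem hnot] at h₂
      omega
    · have huniv : adjoinChain f i.succ = Finset.univ := if_neg (by simpa using hi)
      rw [huniv]
      refine ⟨Finset.ssubset_univ_iff.2 fun he => hnot (he ▸ Finset.mem_univ _),
        fun G hG hAG hGB => ?_⟩
      have h₁ := Finset.card_lt_card hAG
      rcases hG with hG | hG
      · simp only [Fin.val_castSucc] at hcard
        omega
      · exact hGB.ne hG

theorem labelSeq_adjoinChain {n k : ℕ} {f : Fin k → Fin n} (hf : Function.Injective f)
    (hlast : ∀ i : Fin k, (i : ℕ) + 1 = k → ∀ x < f i, ∃ j, f j = x) (i : Fin k) :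
    labelSeq n k (adjoinChain f) i = (f i : ℕ) + 1 := by
  have hnot := notMem_adjoinChain_castSucc hf i
  apply labelSeq_eq_of_isLeast
  by_cases hi : (i : ℕ) + 1 < k
  · rw [adjoinChain_succ f hi, Finset.insert_sdiff_of_notMem _ hnot, Finset.sdiff_self]
    simp
  · have huniv : adjoinChain f i.succ = Finset.univ := if_neg (by simpa using hi)
    rw [huniv]
    refine ⟨by simpa using hnot, fun x hx => ?_⟩
    by_contra! hlt
    obtain ⟨j, rfl⟩ := hlast i (by omega) x hlt
    have hji : j ≠ i := fun h => hlt.ne (h ▸ rfl)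
    have hx' : f j ∉ adjoinChain f i.castSucc := by simpa using hx
    refine hx' ?_
    rw [adjoinChain, if_pos (by simp)]
    refine Finset.mem_image_of_mem f ?_
    simp only [Finset.mem_filter_univ, Fin.val_castSucc]
    have := Fin.val_ne_of_ne hji
    omega

theorem maxChainFlats.exists_isLeast {n k l : ℕ} {F : Fin (l + 1) → Finset (Fin n)}
    (h : maxChainFlats n k l F) :
    ∃ f : Fin l → Fin n, ∀ i, IsLeast (↑(F i.succ \ F i.castSucc) : Set (Fin n)) (f i) := by
  have hne (i : Fin l) : (F i.succ \ F i.castSucc).Nonempty :=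
    Finset.sdiff_nonempty.2 (h.2.2.2 i).1.2
  exact ⟨fun i => (F i.succ \ F i.castSucc).min' (hne i), fun i => Finset.isLeast_min' _ _⟩

theorem maxChainFlats.injective_of_mem_sdiff {n k l : ℕ} {F : Fin (l + 1) → Finset (Fin n)}
    (h : maxChainFlats n k l F) {f : Fin l → Fin n}
    (hf : ∀ i, f i ∈ F i.succ \ F i.castSucc) : Function.Injective f := by
  have hmono : Monotone F := Fin.monotone_iff_le_succ.2 fun i => (h.2.2.2 i).1.subset
  refine Function.Injective.of_lt_imp_ne fun i j hij he => ?_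
  have hi := (Finset.mem_sdiff.1 (hf i)).1
  have hj := (Finset.mem_sdiff.1 (hf j)).2
  exact hj (he ▸ hmono (Fin.succ_le_castSucc_iff.2 hij) hi)

theorem maxChainFlats.eq_adjoinChain {n k : ℕ} {F : Fin (k + 1) → Finset (Fin n)}
    (h : maxChainFlats n k k F) {f : Fin k → Fin n}
    (hf : ∀ i, f i ∈ F i.succ \ F i.castSucc) : F = adjoinChain f := by
  have hmono : Monotone F := Fin.monotone_iff_le_succ.2 fun i => (h.2.2.2 i).1.subset
  funext i
  by_cases hi : (i : ℕ) < k
  · refine (Finset.eq_of_subset_of_card_le ?_ ?_).symm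
    · rw [adjoinChain, if_pos hi]
      refine Finset.image_subset_iff.2 fun j hj => ?_
      have hji : (j : ℕ) < i := by simpa using hj
      exact hmono (Fin.le_def.2 (by simpa using hji)) (Finset.mem_sdiff.1 (hf j)).1
    · rw [h.card_eq i hi, adjoinChain_card (h.injective_of_mem_sdiff hf) hi]
  · have : i = Fin.last k := by
      ext
      simp only [Fin.val_last]
      omega
    rw [this, h.2.1]
    simp [adjoinChain]

/-- For `1 ≤ k ≤ n`: every maximal chain in the lattice of flats of
`U_{k,n}` has length `k`, it has the form `∅ = F₀ ⊂ F₁ ⊂ … ⊂ F_{k-1} ⊂ F_k = [n]` with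
`|F_i| = i` for `i < k`, and the map sending a maximal chain to its label sequence
`(λ_1,…,λ_k)`, `λ_i = min (F_i ∖ F_{i-1})`, is a bijection onto the set of sequences of
pairwise distinct elements of `[n]` satisfying `{1,…,λ_k} ⊆ {λ_1,…,λ_k}`. -/
theorem maxChain_label_bijection (n k : ℕ) (hk : 1 ≤ k) (hkn : k ≤ n) :
    (∀ (l : ℕ) (F : Fin (l + 1) → Finset (Fin n)), maxChainFlats n k l F → l = k)
    ∧ (∀ F : Fin (k + 1) → Finset (Fin n), maxChainFlats n k k F →
        ∀ i : Fin (k + 1), (i : ℕ) < k → (F i).card = (i : ℕ))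
    ∧ Set.BijOn (labelSeq n k)
        {F | maxChainFlats n k k F}
        {lam : Fin k → ℕ | (∀ i, lam i ∈ Finset.Icc 1 n) ∧ Function.Injective lam
          ∧ ∀ m : ℕ, 1 ≤ m → m ≤ lam ⟨k - 1, by omega⟩ → ∃ i, lam i = m} := by
  refine ⟨fun l F h => h.length_eq hk hkn, fun F h => h.card_eq, ?_, ?_, ?_⟩
  · intro F h
    obtain ⟨f, hf⟩ := maxChainFlats.exists_isLeast h
    have hlab (i : Fin k) := labelSeq_eq_of_isLeast (hf i)
    have hinj := h.injective_of_mem_sdiff fun i => (hf i).1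
    refine ⟨fun i => ?_, fun i j hij => ?_, fun m hm hle => ?_⟩
    · rw [hlab, Finset.mem_Icc]
      omega
    · rw [hlab, hlab] at hij
      exact hinj (Fin.ext (by omega))
    · rw [hlab] at hle
      set last : Fin k := ⟨k - 1, by omega⟩ with hlast
      have hmn : m - 1 < n := by omega
      by_cases hmem : (⟨m - 1, hmn⟩ : Fin n) ∈ F last.castSucc
      · rw [h.eq_adjoinChain fun i => (hf i).1, adjoinChain, if_pos (by simp)] at hmem
        obtain ⟨j, -, hj⟩ := Finset.mem_image.1 hmem
        refine ⟨j, ?_⟩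
        rw [hlab, hj]
        exact Nat.sub_add_cancel hm
      · have hsucc : last.succ = Fin.last k := by
          ext
          simp only [hlast, Fin.val_succ, Fin.val_last]
          omega
        have hmin : f last ≤ ⟨m - 1, hmn⟩ :=
          (hf last).2 (by rw [hsucc, h.2.1]; simpa using hmem)
        have hmin' : (f last : ℕ) ≤ m - 1 := hmin
        exact ⟨last, by rw [hlab]; omega⟩
  · intro F hF G hG hFG
    obtain ⟨f, hf⟩ := maxChainFlats.exists_isLeast hF
    obtain ⟨g, hg⟩ := maxChainFlats.exists_isLeast hG
    have hfg : f = g := by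
      funext i
      have := congrFun hFG i
      rw [labelSeq_eq_of_isLeast (hf i), labelSeq_eq_of_isLeast (hg i)] at this
      exact Fin.ext (by omega)
    rw [hF.eq_adjoinChain fun i => (hf i).1, hG.eq_adjoinChain fun i => (hg i).1, hfg]
  · rintro lam ⟨hmem, hinj, hlast⟩
    have hpos (i : Fin k) : 1 ≤ lam i := (Finset.mem_Icc.1 (hmem i)).1
    have hle (i : Fin k) : lam i ≤ n := (Finset.mem_Icc.1 (hmem i)).2
    let f (i : Fin k) : Fin n := ⟨lam i - 1, by have := hpos i; have := hle i; omega⟩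
    have hval (i : Fin k) : (f i : ℕ) + 1 = lam i := Nat.sub_add_cancel (hpos i)
    have hf : Function.Injective f := fun i j hij => hinj (by rw [← hval, ← hval, hij])
    refine ⟨adjoinChain f, maxChainFlats_adjoinChain hk hf, ?_⟩
    funext i
    rw [labelSeq_adjoinChain hf _ i, hval]
    intro i hi x hx
    have hilast : i = ⟨k - 1, by omega⟩ := Fin.ext (by simp only; omega)
    have hxi : (x : ℕ) < f i := hx
    obtain ⟨j, hj⟩ := hlast ((x : ℕ) + 1) (by omega) (by rw [← hilast, ← hval i]; omega)
    exact ⟨j, Fin.ext (by have := hval j; omega)⟩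
end
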